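/- arXiv:1910.13853 — 2 statements merged into one kernel-verified Lean document; each statement's English description precedes it below -/
import Mathlib

section
/- Level-2 phylogenetic networks containing exactly one blob are reconstructible from their shortest distances: if N and N' are level-2 networks on the same leaf set X, N contains exactly one blob, and d_m^{N}(x,y) = d_m^{N'}(x,y) for all leaves x, y ∈ X, then N and N' are isomorphic by an isomorphism fixing the leaf labels. -/
open SimpleGraph

/-- A labelled graph: the raw data of a phylogenetic network on a label set `X`:
a finite vertex type, a simple graph on it, and a labelling map from `X` to vertices. -/
structure LabGraph (X : Type) where
  V : Type
  [fV : Fintype V]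
  G : SimpleGraph V
  leaf : X → V

attribute [instance] LabGraph.fV

namespace LabGraph

variable {X : Type} [Fintype X] [DecidableEq X]

/-- The shortest distance `d_m(x,y)` between the leaves labelled `x` and `y`. -/
noncomputable def dm (N : LabGraph X) (x y : X) : ℕ :=
  N.G.dist (N.leaf x) (N.leaf y)

/-- The multiset `d(x,y)` of the lengths of all paths between the leaves `x` and `y`. -/
noncomputable def dms (N : LabGraph X) (x y : X) : Multiset ℕ := by
  classical
  exact (Finset.univ : Finset (N.G.Path (N.leaf x) (N.leaf y))).val.map fun p => p.1.length

/-- The degree of a vertex. -/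
noncomputable def degOf (N : LabGraph X) (v : N.V) : ℕ := (N.G.neighborSet v).ncard

/-- `N` is an (unweighted unrooted binary) phylogenetic network on `X`:
it is connected, the labelling is injective, and either it is the singleton graph
(when `|X| = 1`), or every leaf-labelled vertex has degree 1 and every other
vertex has degree 3 (so the degree-1 vertices are exactly the labelled leaves). -/
def IsNetwork (N : LabGraph X) : Prop :=
  N.G.Connected ∧ Function.Injective N.leaf ∧
    ((Fintype.card X = 1 ∧ Fintype.card N.V = 1) ∨
      ((∀ x : X, N.degOf (N.leaf x) = 1) ∧
        ∀ v : N.V, v ∉ Set.range N.leaf → N.degOf v = 3))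

/-- Two labelled graphs on `X` are isomorphic by a graph isomorphism fixing the leaf labels. -/
def IsomLabelled (N M : LabGraph X) : Prop :=
  ∃ φ : N.G ≃g M.G, ∀ x : X, φ (N.leaf x) = M.leaf x

/-- A subgraph is 2-connected (with at least three vertices): it is connected and
remains connected after deleting any one of its vertices. -/
def TwoConnSub (N : LabGraph X) (H : N.G.Subgraph) : Prop :=
  3 ≤ H.verts.ncard ∧ H.coe.Connected ∧
    ∀ v ∈ H.verts, (H.deleteVerts {v}).coe.Connected

/-- A blob: a maximal 2-connected subgraph with at least three vertices. -/
def IsBlob (N : LabGraph X) (H : N.G.Subgraph) : Prop :=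
  N.TwoConnSub H ∧ ∀ H' : N.G.Subgraph, N.TwoConnSub H' → H ≤ H' → H' = H

/-- Exactly `r` edges must be deleted from the (connected) subgraph `H` to obtain a
tree: `|E(H)| - |V(H)| + 1 = r`.  A level-1 blob has rank 1, a level-2 blob rank 2. -/
def BlobRank (N : LabGraph X) (H : N.G.Subgraph) (r : ℕ) : Prop :=
  H.edgeSet.ncard + 1 = H.verts.ncard + r

/-- A network is level-`k` if at most `k` edges must be deleted from every blob
to obtain a tree. -/
def IsLevel (N : LabGraph X) (k : ℕ) : Prop :=
  ∀ H : N.G.Subgraph, N.IsBlob H → H.edgeSet.ncard + 1 ≤ H.verts.ncard + k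

/-- A cut-edge: an edge whose deletion disconnects the graph. -/
def IsCutEdge (N : LabGraph X) (e : Sym2 N.V) : Prop :=
  e ∈ N.G.edgeSet ∧ ¬ (N.G.deleteEdges {e}).Connected

/-- A trivial (cut-)edge: one incident to a leaf. -/
def TrivialEdge (N : LabGraph X) (e : Sym2 N.V) : Prop :=
  ∃ x : X, N.leaf x ∈ e

/-- An edge is incident to a blob if one of its endpoints is a vertex of the blob. -/
def EdgeIncBlob (N : LabGraph X) (e : Sym2 N.V) (H : N.G.Subgraph) : Prop :=
  ∃ v ∈ H.verts, v ∈ e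

/-- A pendant blob: a blob with exactly one incident non-trivial cut-edge. -/
def IsPendantBlob (N : LabGraph X) (H : N.G.Subgraph) : Prop :=
  N.IsBlob H ∧
    ∃! e : Sym2 N.V, N.IsCutEdge e ∧ ¬ N.TrivialEdge e ∧ N.EdgeIncBlob e H

/-- A leaf is contained in a blob if its neighbour is a vertex of the blob. -/
def LeafInBlob (N : LabGraph X) (x : X) (H : N.G.Subgraph) : Prop :=
  ∃ v : N.V, N.G.Adj (N.leaf x) v ∧ v ∈ H.verts

/-- `N` has at least two blobs. -/
def TwoBlobs (N : LabGraph X) : Prop :=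
  ∃ H₁ H₂ : N.G.Subgraph, N.IsBlob H₁ ∧ N.IsBlob H₂ ∧ H₁ ≠ H₂

/-- Every leaf of `N` is contained in a blob. -/
def AllLeavesInBlobs (N : LabGraph X) : Prop :=
  ∀ x : X, ∃ H : N.G.Subgraph, N.IsBlob H ∧ N.LeafInBlob x H

/-- A chain: a `k`-tuple of leaves with consecutive shortest distances equal to 3. -/
def IsChainT (N : LabGraph X) (k : ℕ) (a : Fin k → X) : Prop :=
  ∀ (i : ℕ) (h : i + 1 < k),
    N.dm (a ⟨i, Nat.lt_of_succ_lt h⟩) (a ⟨i + 1, h⟩) = 3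

/-- A maximal chain: a chain whose leaf set is not properly contained in the leaf
set of another chain. -/
def IsMaxChainT (N : LabGraph X) (k : ℕ) (a : Fin k → X) : Prop :=
  N.IsChainT k a ∧ ∀ (l : ℕ) (b : Fin l → X), N.IsChainT l b →
    Set.range a ⊆ Set.range b → Set.range a = Set.range b

/-- The chain `a` is contained in the blob `H`: the edges between the neighbours of
consecutive chain leaves are edges of `H`. -/
def ChainInBlob (N : LabGraph X) (k : ℕ) (a : Fin k → X) (H : N.G.Subgraph) : Prop :=
  ∀ (i : ℕ) (h : i + 1 < k) (p q : N.V),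
    N.G.Adj (N.leaf (a ⟨i, Nat.lt_of_succ_lt h⟩)) p →
    N.G.Adj (N.leaf (a ⟨i + 1, h⟩)) q → H.Adj p q

/-- The multiset of natural numbers `A`, viewed in `ℤ`. -/
def toZ (A : Multiset ℕ) : Multiset ℤ := A.map (fun t => (t : ℤ))

/-- `A - n`: subtract `n` from every element of the multiset `A` (in `ℤ`). -/
def zsub (A : Multiset ℕ) (n : ℤ) : Multiset ℤ := A.map (fun t => (t : ℤ) - n)


section Core
open scoped Classical

/-- number of ordered adjacent pairs in `A × B` -/
noncomputable def ee {V : Type} (G : SimpleGraph V) (A B : Finset V) : ℕ :=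
  ∑ u ∈ A, ∑ v ∈ B, if G.Adj u v then 1 else 0

/-- `B` induces a 2-edge-connected graph on at least three vertices -/
def E2 {V : Type} (G : SimpleGraph V) (B : Finset V) : Prop :=
  3 ≤ B.card ∧ ∀ T U : Finset V, T.Nonempty → U.Nonempty → Disjoint T U → T ∪ U = B →
    2 ≤ ee G T U

/-- level-2 condition -/
def Lev2 {V : Type} (G : SimpleGraph V) : Prop :=
  ∀ B : Finset V, E2 G B → ee G B B ≤ 2 * B.card + 2

/-- one-blob condition -/
def One2 {V : Type} (G : SimpleGraph V) : Prop :=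
  (∃ B : Finset V, E2 G B) ∧
    ∀ B₁ B₂ : Finset V, E2 G B₁ → E2 G B₂ → ∃ B, E2 G B ∧ B₁ ⊆ B ∧ B₂ ⊆ B

theorem ee_comm {V : Type} (G : SimpleGraph V) (A B : Finset V) : ee G A B = ee G B A := by
  unfold ee
  rw [Finset.sum_comm]
  simp only [G.adj_comm]

theorem ee_union_left {V : Type} (G : SimpleGraph V) {A A' : Finset V} (B : Finset V)
    (h : Disjoint A A') : ee G (A ∪ A') B = ee G A B + ee G A' B := by
  unfold ee
  rw [Finset.sum_union h]

theorem ee_union_right {V : Type} (G : SimpleGraph V) {A A' : Finset V} (B : Finset V)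
    (h : Disjoint A A') : ee G B (A ∪ A') = ee G B A + ee G B A' := by
  rw [ee_comm, ee_union_left G B h, ee_comm, ee_comm G A']

theorem ee_single {V : Type} (G : SimpleGraph V) (u v : V) :
    ee G {u} {v} = if G.Adj u v then 1 else 0 := by
  simp only [ee, Finset.sum_singleton]

theorem ee_self {V : Type} (G : SimpleGraph V) (u : V) : ee G {u} {u} = 0 := by
  simp [ee]

theorem ee_eq_card {V : Type} (G : SimpleGraph V) (A B : Finset V) :
    ee G A B = ((A ×ˢ B).filter (fun q => G.Adj q.1 q.2)).card := by
  unfold ee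
  rw [Finset.card_filter, Finset.sum_product]

theorem ee_mono {V : Type} (G : SimpleGraph V) {A A' B B' : Finset V} (h : A ⊆ A') (h' : B ⊆ B') :
    ee G A B ≤ ee G A' B' := by
  rw [ee_eq_card, ee_eq_card]
  exact Finset.card_le_card (Finset.filter_subset_filter _ (Finset.product_subset_product h h'))

theorem ee_pos {V : Type} (G : SimpleGraph V) {A B : Finset V} :
    0 < ee G A B ↔ ∃ u ∈ A, ∃ v ∈ B, G.Adj u v := by
  rw [ee_eq_card, Finset.card_pos]
  constructor
  · rintro ⟨q, hq⟩
    simp only [Finset.mem_filter, Finset.mem_product] at hq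
    exact ⟨q.1, hq.1.1, q.2, hq.1.2, hq.2⟩
  · rintro ⟨u, hu, v, hv, h⟩
    exact ⟨(u, v), by simp [hu, hv, h]⟩

theorem ee_eq_zero {V : Type} (G : SimpleGraph V) {A B : Finset V} :
    ee G A B = 0 ↔ ∀ u ∈ A, ∀ v ∈ B, ¬ G.Adj u v := by
  have := ee_pos G (A := A) (B := B)
  constructor
  · intro h u hu v hv hh
    have := this.2 ⟨u, hu, v, hv, hh⟩
    omega
  · intro h
    by_contra hne
    obtain ⟨u, hu, v, hv, hh⟩ := this.1 (Nat.pos_of_ne_zero hne)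
    exact h u hu v hv hh

theorem ee_unique {V : Type} (G : SimpleGraph V) {A B : Finset V} (h : ee G A B ≤ 1)
    {u v u' v' : V} (hu : u ∈ A) (hv : v ∈ B) (hu' : u' ∈ A) (hv' : v' ∈ B)
    (a : G.Adj u v) (a' : G.Adj u' v') : u = u' ∧ v = v' := by
  rw [ee_eq_card, Finset.card_le_one] at h
  have := h (u, v) (by simp [hu, hv, a]) (u', v') (by simp [hu', hv', a'])
  simpa using this

theorem ee_single_le {V : Type} (G : SimpleGraph V) (u : V) (B : Finset V) :
    ee G {u} B ≤ B.card := by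
  rw [ee_eq_card]
  refine (Finset.card_filter_le _ _).trans ?_
  simp

theorem ee_even {V : Type} (G : SimpleGraph V) (T : Finset V) : Even (ee G T T) := by
  induction T using Finset.induction_on with
  | empty => simp [ee]
  | insert a s ha ih =>
    have hd : Disjoint {a} s := by simpa using ha
    rw [Finset.insert_eq, ee_union_left G _ hd, ee_union_right G _ hd, ee_union_right G _ hd,
      ee_self, ee_comm G s {a}]
    obtain ⟨k, hk⟩ := ih
    exact ⟨ee G {a} s + k, by omega⟩

theorem ee_three {V : Type} (G : SimpleGraph V) (T : Finset V) (h : T.card = 3) :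
    ee G T T ≤ 6 := by
  have h1 : ∀ v ∈ T, ee G {v} T ≤ 2 := by
    intro v hv
    have e : T = {v} ∪ T.erase v := by rw [← Finset.insert_eq, Finset.insert_erase hv]
    have hd : Disjoint {v} (T.erase v) := by simp
    have h2 := ee_single_le G v (T.erase v)
    rw [Finset.card_erase_of_mem hv, h] at h2
    rw [e, ee_union_right G _ hd, ee_self]
    omega
  have h3 : ee G T T = ∑ v ∈ T, ee G {v} T := by simp [ee]
  rw [h3]
  have := Finset.sum_le_card_nsmul T _ 2 h1
  rw [h] at this
  simpa using this

theorem ee_sum {V : Type} (G : SimpleGraph V) (A B : Finset V) (k : ℕ)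
    (h : ∀ v ∈ A, ee G {v} B = k) : ee G A B = k * A.card := by
  have : ee G A B = ∑ v ∈ A, ee G {v} B := by simp [ee]
  rw [this, Finset.sum_congr rfl h]
  simp [mul_comm]

/-- minimal sets with small boundary -/
theorem min_cut {V : Type} (G : SimpleGraph V) (K : Finset V) :
    ∀ (n : ℕ) (Q W : Finset V), Q.card = n → Q.Nonempty → Disjoint Q W → Q ∪ W = K →
      ee G Q W ≤ 1 →
      ∃ Q' W', Q' ⊆ Q ∧ Q'.Nonempty ∧ Disjoint Q' W' ∧ Q' ∪ W' = K ∧ ee G Q' W' ≤ 1 ∧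
        (Q'.card = 1 ∨ E2 G Q') := by
  intro n
  induction n using Nat.strong_induction_on with
  | _ n ih =>
    intro Q W hn hQ hd hK hc
    by_cases h : ∃ T U : Finset V, T.Nonempty ∧ U.Nonempty ∧ Disjoint T U ∧ T ∪ U = Q ∧
        ee G T U ≤ 1
    · obtain ⟨T, U, hT, hU, hTU, rfl, hle⟩ := h
      have hcard := Finset.card_union_of_disjoint hTU
      have hT' := hT.card_pos
      have hU' := hU.card_pos
      rw [Finset.disjoint_union_left] at hd
      have e1 := ee_union_left G W hTU
      have e2 := ee_union_right G T (A := U) (A' := W) hd.2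
      have e3 := ee_union_right G U (A := T) (A' := W) hd.1
      have e4 := ee_comm G U T
      rcases (by omega : ee G T (U ∪ W) ≤ 1 ∨ ee G U (T ∪ W) ≤ 1) with h1 | h1
      · obtain ⟨Q', W', a, b⟩ := ih T.card (by omega) T (U ∪ W) rfl hT
          (Finset.disjoint_union_right.2 ⟨hTU, hd.1⟩) (by rw [← hK, Finset.union_assoc]) h1
        exact ⟨Q', W', a.trans Finset.subset_union_left, b⟩
      · obtain ⟨Q', W', a, b⟩ := ih U.card (by omega) U (T ∪ W) rfl hU
          (Finset.disjoint_union_right.2 ⟨hTU.symm, hd.2⟩)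
          (by rw [← hK, ← Finset.union_assoc, Finset.union_comm U T]) h1
        exact ⟨Q', W', a.trans Finset.subset_union_right, b⟩
    · refine ⟨Q, W, subset_rfl, hQ, hd, hK, hc, ?_⟩
      by_cases h1 : Q.card = 1
      · exact Or.inl h1
      right
      have h0 := hQ.card_pos
      refine ⟨?_, fun T U a b c d => ?_⟩
      · by_contra hlt
        obtain ⟨u, v, huv, rfl⟩ := Finset.card_eq_two.1 (by omega : Q.card = 2)
        refine h ⟨{u}, {v}, by simp, by simp, by simpa using huv, by rfl, ?_⟩
        simpa using ee_single_le G u {v}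
      · by_contra hlt
        exact h ⟨T, U, a, b, c, d, by omega⟩

/-- the core (set of non-leaf vertices) of a cherry-free network -/
structure CF {V Y : Type} (G : SimpleGraph V) (K : Finset V) (p : Y → V) : Prop where
  inj : Function.Injective p
  mem : ∀ x, p x ∈ K
  deg2 : ∀ x, ee G {p x} K = 2
  deg3 : ∀ v ∈ K, v ∉ Set.range p → ee G {v} K = 3
  conn : ∀ T U : Finset V, T.Nonempty → U.Nonempty → Disjoint T U → T ∪ U = K → 1 ≤ ee G T U

/-- Each leafless part of the core has boundary at least two. -/
theorem CF.leafless {V Y : Type} {G : SimpleGraph V} {K : Finset V} {p : Y → V}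
    (h : CF G K p) (hl : Lev2 G) (Q W : Finset V) (hQ : Q.Nonempty) (hd : Disjoint Q W)
    (hK : Q ∪ W = K) (hp : ∀ x, p x ∉ Q) : 2 ≤ ee G Q W := by
  by_contra hlt
  obtain ⟨Q', W', hs, hn, hd', hK', hc, h1⟩ := min_cut G K _ Q W rfl hQ hd hK (by omega)
  have h3 : ∀ v ∈ Q', ee G {v} K = 3 := by
    intro v hv
    refine h.deg3 v (hK ▸ Finset.mem_union_left _ (hs hv)) ?_
    rintro ⟨x, rfl⟩
    exact hp x (hs hv)
  have e1 := ee_sum G Q' K 3 h3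
  rw [← hK', ee_union_right G _ hd'] at e1
  rcases h1 with h1 | h1
  · obtain ⟨v, rfl⟩ := Finset.card_eq_one.1 h1
    rw [ee_self] at e1
    omega
  · have := hl Q' h1
    have h4 := h1.1
    have h5 := ee_three G Q'
    omega

theorem CF.small_cut {V Y : Type} {G : SimpleGraph V} {K : Finset V} {p : Y → V}
    (h : CF G K p) (Q W : Finset V) (hQ : Q.Nonempty) (hd : Disjoint Q W)
    (hK : Q ∪ W = K) (hc : ee G Q W ≤ 1) : ∃ B, B ⊆ Q ∧ E2 G B := by
  obtain ⟨Q', W', hs, hn, hd', hK', hc, h1⟩ := min_cut G K _ Q W rfl hQ hd hK hc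
  rcases h1 with h1 | h1
  · exfalso
    obtain ⟨v, rfl⟩ := Finset.card_eq_one.1 h1
    have h2 : 2 ≤ ee G {v} K := by
      by_cases hv : v ∈ Set.range p
      · obtain ⟨x, rfl⟩ := hv
        exact (h.deg2 x).ge
      · rw [h.deg3 v (by rw [← hK']; simp) hv]
        omega
    rw [← hK', ee_union_right G _ hd', ee_self] at h2
    omega
  · exact ⟨Q', hs, h1⟩

/-- The core of a cherry-free one-blob network is 2-edge-connected. -/
theorem CF.bridgeless {V Y : Type} {G : SimpleGraph V} {K : Finset V} {p : Y → V}
    (h : CF G K p) (ho : One2 G) (hB : ∀ B, E2 G B → B ⊆ K) : E2 G K := by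
  obtain ⟨⟨B, hB0⟩, ho⟩ := ho
  refine ⟨hB0.1.trans (Finset.card_le_card (hB B hB0)), fun T U hT hU hd hK => ?_⟩
  by_contra hlt
  obtain ⟨B1, hs1, hb1⟩ := h.small_cut T U hT hd hK (by omega)
  obtain ⟨B2, hs2, hb2⟩ := h.small_cut U T hU hd.symm (by rw [Finset.union_comm, hK])
    (by rw [ee_comm]; omega)
  obtain ⟨C, hC, h1, h2⟩ := ho B1 B2 hb1 hb2
  have hCK := hB C hC
  have n1 : B1.Nonempty := Finset.card_pos.1 (by have := hb1.1; omega)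
  have n2 : B2.Nonempty := Finset.card_pos.1 (by have := hb2.1; omega)
  have := hC.2 (C ∩ T) (C ∩ U)
    (n1.mono (Finset.subset_inter h1 hs1)) (n2.mono (Finset.subset_inter h2 hs2))
    (hd.mono Finset.inter_subset_right Finset.inter_subset_right)
    (by rw [← Finset.inter_union_distrib_left, hK, Finset.inter_eq_left.2 hCK])
  have := ee_mono G (A := C ∩ T) (A' := T) (B := C ∩ U) (B' := U)
    Finset.inter_subset_right Finset.inter_subset_right
  omega

/-- two cherry-free cores with matching leaf relations; the first one is 2-edge-connected with
exactly two vertices without leaf -/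
structure Ctx {V V' Y : Type} [Fintype Y] (G : SimpleGraph V) (G' : SimpleGraph V')
    (K : Finset V) (K' : Finset V') (p : Y → V) (p' : Y → V') (s t : V) : Prop where
  cf : CF G K p
  cf' : CF G' K' p'
  e2 : E2 G K
  lev : Lev2 G'
  ne : s ≠ t
  hs : ∀ x, p x ≠ s
  ht : ∀ x, p x ≠ t
  hK : K = Finset.univ.image p ∪ ({s} ∪ {t})
  h3 : ∀ x y, G.Adj (p x) (p y) ↔ G'.Adj (p' x) (p' y)
  h4 : ∀ x y, x ≠ y → ¬ G.Adj (p x) (p y) → (∃ w, G.Adj w (p x) ∧ G.Adj w (p y)) →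
    ∃ w ∈ K', G'.Adj w (p' x) ∧ G'.Adj w (p' y)

theorem ee_image {V V' Y : Type} {G : SimpleGraph V} {G' : SimpleGraph V'}
    {p : Y → V} {p' : Y → V'} (hp : Function.Injective p) (hp' : Function.Injective p')
    (h3 : ∀ x y, G.Adj (p x) (p y) ↔ G'.Adj (p' x) (p' y)) (A B : Finset Y) :
    ee G (A.image p) (B.image p) = ee G' (A.image p') (B.image p') := by
  unfold ee
  simp only [Finset.sum_image (hp.injOn), Finset.sum_image (hp'.injOn), h3]

theorem Ctx.swap {V V' Y : Type} [Fintype Y] {G : SimpleGraph V} {G' : SimpleGraph V'}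
    {K : Finset V} {K' : Finset V'} {p : Y → V} {p' : Y → V'} {s t : V}
    (c : Ctx G G' K K' p p' s t) : Ctx G G' K K' p p' t s :=
  ⟨c.cf, c.cf', c.e2, c.lev, c.ne.symm, c.ht, c.hs, by rw [c.hK, Finset.union_comm {s}],
    c.h3, c.h4⟩

theorem Ctx.sK {V V' Y : Type} [Fintype Y] {G : SimpleGraph V} {G' : SimpleGraph V'}
    {K : Finset V} {K' : Finset V'} {p : Y → V} {p' : Y → V'} {s t : V}
    (c : Ctx G G' K K' p p' s t) : s ∈ K := by rw [c.hK]; simp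

theorem Ctx.degs {V V' Y : Type} [Fintype Y] {G : SimpleGraph V} {G' : SimpleGraph V'}
    {K : Finset V} {K' : Finset V'} {p : Y → V} {p' : Y → V'} {s t : V}
    (c : Ctx G G' K K' p p' s t) : ee G {s} K = 3 :=
  c.cf.deg3 s c.sK (by rintro ⟨x, hx⟩; exact c.hs x hx)

/-- Two leaves attached next to the same pole `s` are attached next to a common leafless
vertex in the other network. -/
theorem Ctx.common {V V' Y : Type} [Fintype Y] {G : SimpleGraph V} {G' : SimpleGraph V'}
    {K : Finset V} {K' : Finset V'} {p : Y → V} {p' : Y → V'} {s t : V}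
    (c : Ctx G G' K K' p p' s t) {x y : Y} (hxy : x ≠ y) (hx : G.Adj s (p x))
    (hy : G.Adj s (p y)) :
    ∃ w ∈ K', (∀ z, p' z ≠ w) ∧ G'.Adj w (p' x) ∧ G'.Adj w (p' y) := by
  have hpxy : p x ≠ p y := fun h => hxy (c.cf.inj h)
  have hsx := c.hs x
  have hsy := c.hs y
  have d1 : Disjoint {p x} ({p y} : Finset V) := by simpa using hpxy
  have d2 : Disjoint ({p x} ∪ {p y}) ({s} : Finset V) := by
    simp [hsx.symm, hsy.symm]
  have key : ∀ T : Finset V, T ⊆ K → T.Nonempty → t ∉ T → ee G T T + 2 ≤ ee G T K := by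
    intro T hT hn ht
    have hd : Disjoint T (K \ T) := Finset.disjoint_sdiff
    have hu : T ∪ (K \ T) = K := Finset.union_sdiff_of_subset hT
    have := c.e2.2 T (K \ T) hn ⟨t, by simp [ht, c.swap.sK]⟩ hd hu
    have h2 := ee_union_right G T hd
    rw [hu] at h2
    omega
  have a1 := c.cf.deg2 x
  have a2 := c.cf.deg2 y
  have a3 := c.degs
  have hnadj : ¬ G.Adj (p x) (p y) := by
    intro hadj
    have := key (({p x} ∪ {p y}) ∪ {s}) (by
      intro v; simp only [Finset.mem_union, Finset.mem_singleton]
      rintro ((rfl | rfl) | rfl)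
      exacts [c.cf.mem _, c.cf.mem _, c.sK]) ⟨s, by simp⟩
      (by simp [(c.ht x).symm, (c.ht y).symm, c.ne.symm])
    simp only [ee_union_left G _ d2, ee_union_left G _ d1, ee_union_right G _ d2,
      ee_union_right G _ d1, a1, a2, a3, ee_single, hadj, hadj.symm, hx, hx.symm, hy, hy.symm,
      G.irrefl, if_true, if_false] at this
    omega
  obtain ⟨w, hwK, hw1, hw2⟩ := c.h4 x y hxy hnadj ⟨s, hx, hy⟩
  refine ⟨w, hwK, ?_, hw1, hw2⟩
  rintro z rfl
  have b1 := (c.h3 _ _).2 hw1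
  have b2 := (c.h3 _ _).2 hw2
  have a4 := c.cf.deg2 z
  have d3 : Disjoint (({p x} ∪ {p y}) ∪ {s}) ({p z} : Finset V) := by
    simp [c.hs z, b1.ne, b2.ne]
  have := key ((({p x} ∪ {p y}) ∪ {s}) ∪ {p z}) (by
      intro v; simp only [Finset.mem_union, Finset.mem_singleton]
      rintro (((rfl | rfl) | rfl) | rfl)
      exacts [c.cf.mem _, c.cf.mem _, c.sK, c.cf.mem _]) ⟨s, by simp⟩
      (by simp [(c.ht x).symm, (c.ht y).symm, (c.ht z).symm, c.ne.symm])
  simp only [ee_union_left G _ d2, ee_union_left G _ d1, ee_union_right G _ d2,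
      ee_union_left G _ d3, ee_union_right G _ d3,
      ee_union_right G _ d1, a1, a2, a3, a4, ee_single, hx, hx.symm, hy, hy.symm,
      b1, b2, b1.symm, b2.symm, G.irrefl, if_true, if_false] at this
  omega

/-- The final step of the bridge analysis. -/
theorem Ctx.case2 {V V' Y : Type} [Fintype Y] {G : SimpleGraph V} {G' : SimpleGraph V'}
    {K : Finset V} {K' : Finset V'} {p : Y → V} {p' : Y → V'} {s t : V}
    (c : Ctx G G' K K' p p' s t) (Q1 Q2 : Finset V') (hd : Disjoint Q1 Q2) (hQ : Q1 ∪ Q2 = K')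
    (hle : ee G' Q1 Q2 ≤ 1)
    (hno : ∀ x y, p' x ∈ Q1 → p' y ∈ Q2 → ¬ G.Adj (p x) (p y))
    (a1 a2 c1 c2 : Y) (ha1 : p' a1 ∈ Q1) (ha2 : p' a2 ∈ Q2) (hc1 : p' c1 ∈ Q1)
    (hc2 : p' c2 ∈ Q2) (sa1 : G.Adj s (p a1)) (sa2 : G.Adj s (p a2)) (tc1 : G.Adj t (p c1))
    (tc2 : G.Adj t (p c2)) (w : V') (hw : w ∈ Q1) (hwp : ∀ z, p' z ≠ w) (b : Y)
    (hb : p' b ∈ Q2) (hwb : G'.Adj w (p' b)) : False := by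
  have hne : ∀ {x y}, p' x ∈ Q1 → p' y ∈ Q2 → x ≠ y := by
    rintro x y hx hy rfl
    exact (Finset.disjoint_left.1 hd hx) hy
  -- every leaf on the second side next to a pole is b
  have gen : ∀ w' ∈ K', (∀ z, p' z ≠ w') → ∀ x z, p' x ∈ Q1 → p' z ∈ Q2 → G'.Adj w' (p' x) →
      G'.Adj w' (p' z) → z = b := by
    intro w' hw' hw'p x z hx hz h1 h2
    rw [← hQ, Finset.mem_union] at hw'
    rcases hw' with hw' | hw'
    · exact c.cf'.inj (ee_unique G' hle hw' hz hw hb h2 hwb).2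
    · exact absurd (ee_unique G' hle hx hw' hw hb h1.symm hwb).1 (hwp x)
  have gs : ∀ z, p' z ∈ Q2 → G.Adj s (p z) → z = b := by
    intro z hz h
    obtain ⟨w', h1, h2, h3, h4⟩ := c.common (hne ha1 hz) sa1 h
    exact gen w' h1 h2 a1 z ha1 hz h3 h4
  have gt : ∀ z, p' z ∈ Q2 → G.Adj t (p z) → z = b := by
    intro z hz h
    obtain ⟨w', h1, h2, h3, h4⟩ := c.swap.common (hne hc1 hz) tc1 h
    exact gen w' h1 h2 c1 z hc1 hz h3 h4
  have sb : G.Adj s (p b) := gs a2 ha2 sa2 ▸ sa2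
  have tb : G.Adj t (p b) := gt c2 hc2 tc2 ▸ tc2
  have dst : Disjoint {s} ({t} : Finset V) := by simpa using c.ne
  -- b is the only leaf on the second side
  have only : ∀ z, p' z ∈ Q2 → z = b := by
    intro z hz
    by_contra hzb
    set T : Finset V := (Finset.univ.filter (fun y => p' y ∈ Q2 ∧ y ≠ b)).image p with hT
    have hTm : ∀ v, v ∈ T ↔ ∃ y, p' y ∈ Q2 ∧ y ≠ b ∧ p y = v := by
      intro v; simp [hT, and_assoc]
    have hTK : T ⊆ K := by
      intro v hv
      obtain ⟨y, -, -, rfl⟩ := (hTm v).1 hv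
      exact c.cf.mem y
    have := c.e2.2 T (K \ T) ⟨p z, (hTm _).2 ⟨z, hz, hzb, rfl⟩⟩
      ⟨s, by
        rw [Finset.mem_sdiff]
        refine ⟨c.sK, fun h => ?_⟩
        obtain ⟨y, -, -, h⟩ := (hTm s).1 h
        exact c.hs y h⟩ Finset.disjoint_sdiff (Finset.union_sdiff_of_subset hTK)
    have h0 : ee G T (K \ T) = 0 := by
      rw [ee_eq_zero]
      intro u hu v hv huv
      obtain ⟨y, hy, hyb, rfl⟩ := (hTm u).1 hu
      rw [Finset.mem_sdiff, c.hK] at hv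
      obtain ⟨hv, hvT⟩ := hv
      simp only [Finset.mem_union, Finset.mem_image, Finset.mem_univ, true_and,
        Finset.mem_singleton] at hv
      rcases hv with ⟨q, rfl⟩ | rfl | rfl
      · have hq : p' q ∈ Q1 ∪ Q2 := hQ ▸ c.cf'.mem q
        rcases Finset.mem_union.1 hq with hq | hq
        · exact hno q y hq hy huv.symm
        · have hqb : q = b := by
            by_contra hqb
            exact hvT ((hTm _).2 ⟨q, hq, hqb, rfl⟩)
          subst hqb
          have d3 : Disjoint ({s} ∪ {t}) ({p y} : Finset V) := by
            simp [c.hs y, c.ht y]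
          have hsub : ({s} ∪ {t}) ∪ ({p y} : Finset V) ⊆ K := by
            intro v; simp only [Finset.mem_union, Finset.mem_singleton]
            rintro ((rfl | rfl) | rfl)
            exacts [c.sK, c.swap.sK, c.cf.mem _]
          have h5 := ee_mono G (subset_refl {p q}) hsub
          rw [c.cf.deg2 q, ee_union_right G _ d3, ee_union_right G _ dst] at h5
          simp only [ee_single, sb.symm, tb.symm, huv.symm, if_true] at h5
          omega
      · exact hyb (gs y hy huv.symm)
      · exact hyb (gt y hy huv.symm)
    omega
  -- now the rest of the second side is leafless
  have hd' : Disjoint {p' b} (Q2.erase (p' b)) := by simp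
  have hu' : {p' b} ∪ (Q2.erase (p' b)) = Q2 := by
    rw [← Finset.insert_eq, Finset.insert_erase hb]
  have hsub : Q2.erase (p' b) ⊆ Q2 := Finset.erase_subset _ _
  have hdb : Disjoint {p' b} Q1 := by
    rw [Finset.disjoint_singleton_left]
    exact Finset.disjoint_right.1 hd hb
  have e1 := c.cf'.deg2 b
  rw [← hQ, ee_union_right G' _ hd, ← hu', ee_union_right G' _ hd', ee_self] at e1
  have e2 := hle
  rw [← hu', ee_comm, ee_union_left G' _ hd'] at e2
  have e3 : 0 < ee G' {p' b} Q1 := (ee_pos G').2 ⟨p' b, by simp, w, hw, hwb.symm⟩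
  have hne : (Q2.erase (p' b)).Nonempty := by
    rw [Finset.nonempty_iff_ne_empty]
    intro h
    rw [h] at e1
    have : ee G' {p' b} ∅ = 0 := by simp [ee]
    omega
  have hdq : Disjoint (Q2.erase (p' b)) Q1 := (hd.mono_right hsub).symm
  have := c.cf'.leafless c.lev (Q2.erase (p' b)) ({p' b} ∪ Q1) hne
    (Finset.disjoint_union_right.2 ⟨hd'.symm, hdq⟩)
    (by rw [← hQ, ← Finset.union_assoc, Finset.union_comm _ {p' b}, hu', Finset.union_comm])
    (by
      intro x hx
      have := only x (hsub hx)
      subst this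
      simp at hx)
  rw [ee_union_right G' _ hdb, ee_comm G' _ {p' b}] at this
  omega

theorem Ctx.count {V V' Y : Type} [Fintype Y] {G : SimpleGraph V} {G' : SimpleGraph V'}
    {K : Finset V} {K' : Finset V'} {p : Y → V} {p' : Y → V'} {s t : V}
    (c : Ctx G G' K K' p p' s t) :
    ee G {s} (Finset.univ.image p) + ee G {s} {t} = 3 := by
  have d1 : Disjoint (Finset.univ.image p) ({s} ∪ {t}) := by
    rw [Finset.disjoint_union_right]
    simp [c.hs, c.ht]
  have d2 : Disjoint {s} ({t} : Finset V) := by simpa using c.ne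
  have := c.degs
  rw [c.hK, ee_union_right G _ d1, ee_union_right G _ d2, ee_self] at this
  omega

/-- each leaf-carrying vertex has as many leafless neighbours in both networks -/
theorem Ctx.count_leaf {V V' Y : Type} [Fintype Y] {G : SimpleGraph V} {G' : SimpleGraph V'}
    {K : Finset V} {K' : Finset V'} {p : Y → V} {p' : Y → V'} {s t : V}
    (c : Ctx G G' K K' p p' s t) (x : Y) :
    ee G {p x} ({s} ∪ {t}) = ee G' {p' x} (K' \ Finset.univ.image p') := by
  have d1 : Disjoint (Finset.univ.image p) ({s} ∪ {t}) := by
    rw [Finset.disjoint_union_right]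
    simp [c.hs, c.ht]
  have e1 := c.cf.deg2 x
  have e2 := c.cf'.deg2 x
  have hsub : Finset.univ.image p' ⊆ K' := by
    intro v hv
    obtain ⟨y, -, rfl⟩ := Finset.mem_image.1 hv
    exact c.cf'.mem y
  have hd : Disjoint (Finset.univ.image p') (K' \ Finset.univ.image p') := Finset.disjoint_sdiff
  rw [← Finset.union_sdiff_of_subset hsub, ee_union_right G' _ hd] at e2
  rw [c.hK, ee_union_right G _ d1] at e1
  have e3 := ee_image c.cf.inj c.cf'.inj c.h3 {x} Finset.univ
  rw [Finset.image_singleton, Finset.image_singleton] at e3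
  omega

theorem ee_sum_image {V Y : Type} {G : SimpleGraph V} {p : Y → V}
    (hp : Function.Injective p) (A : Finset Y) (B : Finset V) :
    ee G (A.image p) B = ∑ x ∈ A, ee G {p x} B := by
  unfold ee
  rw [Finset.sum_image hp.injOn]
  simp only [Finset.sum_singleton]

theorem Ctx.count_all {V V' Y : Type} [Fintype Y] {G : SimpleGraph V} {G' : SimpleGraph V'}
    {K : Finset V} {K' : Finset V'} {p : Y → V} {p' : Y → V'} {s t : V}
    (c : Ctx G G' K K' p p' s t) :
    ee G' (Finset.univ.image p') (K' \ Finset.univ.image p') + 2 * ee G {s} {t} = 6 := by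
  have d2 : Disjoint {s} ({t} : Finset V) := by simpa using c.ne
  have e1 : ee G (Finset.univ.image p) ({s} ∪ {t}) =
      ee G' (Finset.univ.image p') (K' \ Finset.univ.image p') := by
    rw [ee_sum_image c.cf.inj, ee_sum_image c.cf'.inj]
    exact Finset.sum_congr rfl fun x _ => c.count_leaf x
  rw [← e1, ee_union_right G _ d2]
  have h1 := c.count
  have h2 := c.swap.count
  rw [ee_comm] at h1 h2
  rw [ee_comm G {t} {s}] at h2
  rw [ee_comm G {s} {t}] at h1 h2 ⊢
  omega

/-- The core of the second network is 2-edge-connected, too. -/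
theorem Ctx.e2' {V V' Y : Type} [Fintype Y] {G : SimpleGraph V} {G' : SimpleGraph V'}
    {K : Finset V} {K' : Finset V'} {p : Y → V} {p' : Y → V'} {s t : V}
    (c : Ctx G G' K K' p p' s t) : E2 G' K' := by
  have hst : ee G {s} {t} ≤ 1 := by rw [ee_single]; split_ifs <;> omega
  have hsub : Finset.univ.image p' ⊆ K' := by
    intro v hv
    obtain ⟨y, -, rfl⟩ := Finset.mem_image.1 hv
    exact c.cf'.mem y
  refine ⟨?_, fun Q1 Q2 n1 n2 hd hQ => ?_⟩
  · have h1 := c.count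
    have h2 := ee_single_le G s (Finset.univ.image p)
    rw [Finset.card_image_of_injective _ c.cf.inj, ← Finset.card_image_of_injective _ c.cf'.inj]
      at h2
    have h3 := c.count_all
    obtain ⟨u, -, v, hv, -⟩ := (ee_pos G').1 (by omega :
      0 < ee G' (Finset.univ.image p') (K' \ Finset.univ.image p'))
    have h4 : 0 < (K' \ Finset.univ.image p').card := Finset.card_pos.2 ⟨v, hv⟩
    have h5 := Finset.card_sdiff_add_card_eq_card hsub
    omega
  · by_contra hlt
    have hle : ee G' Q1 Q2 ≤ 1 := by omega
    obtain ⟨x1, hx1⟩ : ∃ x, p' x ∈ Q1 := by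
      by_contra hcon
      have := c.cf'.leafless c.lev Q1 Q2 n1 hd hQ (fun x hx => hcon ⟨x, hx⟩)
      omega
    obtain ⟨x2, hx2⟩ : ∃ x, p' x ∈ Q2 := by
      by_contra hcon
      have := c.cf'.leafless c.lev Q2 Q1 n2 hd.symm (by rw [Finset.union_comm, hQ])
        (fun x hx => hcon ⟨x, hx⟩)
      rw [ee_comm] at this
      omega
    set L1 : Finset V := (Finset.univ.filter (fun y => p' y ∈ Q1)).image p with hL1
    set L2 : Finset V := (Finset.univ.filter (fun y => p' y ∈ Q2)).image p with hL2
    have m1 : ∀ v, v ∈ L1 ↔ ∃ y, p' y ∈ Q1 ∧ p y = v := by intro v; simp [hL1]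
    have m2 : ∀ v, v ∈ L2 ↔ ∃ y, p' y ∈ Q2 ∧ p y = v := by intro v; simp [hL2]
    have d12 : Disjoint L1 L2 := by
      rw [Finset.disjoint_left]
      intro v h1 h2
      obtain ⟨y, hy, rfl⟩ := (m1 v).1 h1
      obtain ⟨z, hz, hzy⟩ := (m2 _).1 h2
      have := c.cf.inj hzy
      subst this
      exact Finset.disjoint_left.1 hd hy hz
    have d1s : Disjoint L1 {s} := by
      rw [Finset.disjoint_singleton_right, m1]; rintro ⟨y, -, h⟩; exact c.hs y h
    have d2s : Disjoint L2 {s} := by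
      rw [Finset.disjoint_singleton_right, m2]; rintro ⟨y, -, h⟩; exact c.hs y h
    have d1t : Disjoint L1 {t} := by
      rw [Finset.disjoint_singleton_right, m1]; rintro ⟨y, -, h⟩; exact c.ht y h
    have d2t : Disjoint L2 {t} := by
      rw [Finset.disjoint_singleton_right, m2]; rintro ⟨y, -, h⟩; exact c.ht y h
    have dst : Disjoint {s} ({t} : Finset V) := by simpa using c.ne
    have hL : Finset.univ.image p = L1 ∪ L2 := by
      ext v
      simp only [Finset.mem_image, Finset.mem_univ, true_and, Finset.mem_union, m1, m2]
      constructor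
      · rintro ⟨y, rfl⟩
        have := c.cf'.mem y
        rw [← hQ, Finset.mem_union] at this
        rcases this with h | h
        · exact Or.inl ⟨y, h, rfl⟩
        · exact Or.inr ⟨y, h, rfl⟩
      · rintro (⟨y, -, rfl⟩ | ⟨y, -, rfl⟩) <;> exact ⟨y, rfl⟩
    have hK : K = (L1 ∪ L2) ∪ ({s} ∪ {t}) := by rw [c.hK, hL]
    have dL : Disjoint (L1 ∪ L2) ({s} ∪ {t}) := by
      simp only [Finset.disjoint_union_left, Finset.disjoint_union_right]
      exact ⟨⟨d1s, d2s⟩, d1t, d2t⟩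
    have ne1 : L1.Nonempty := ⟨p x1, (m1 _).2 ⟨x1, hx1, rfl⟩⟩
    have ne2 : L2.Nonempty := ⟨p x2, (m2 _).2 ⟨x2, hx2, rfl⟩⟩
    -- degrees
    have gs := c.count
    have gt := c.swap.count
    rw [hL, ee_union_right G _ d12] at gs gt
    rw [ee_comm G {t} {s}] at gt
    have deg1 : ee G L1 K = 2 * L1.card := ee_sum G L1 K 2 (by
      intro v hv; obtain ⟨y, -, rfl⟩ := (m1 v).1 hv; exact c.cf.deg2 y)
    have deg2 : ee G L2 K = 2 * L2.card := ee_sum G L2 K 2 (by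
      intro v hv; obtain ⟨y, -, rfl⟩ := (m2 v).1 hv; exact c.cf.deg2 y)
    rw [hK, ee_union_right G _ dL, ee_union_right G _ d12, ee_union_right G _ dst] at deg1 deg2
    obtain ⟨k1, hk1⟩ := ee_even G L1
    obtain ⟨k2, hk2⟩ := ee_even G L2
    -- cuts
    have c1 := c.e2.2 L1 (L2 ∪ ({s} ∪ {t})) ne1 (ne2.mono Finset.subset_union_left)
      (by simp only [Finset.disjoint_union_right]; exact ⟨d12, d1s, d1t⟩)
      (by rw [hK, Finset.union_assoc])
    have c2 := c.e2.2 L2 (L1 ∪ ({s} ∪ {t})) ne2 (ne1.mono Finset.subset_union_left)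
      (by simp only [Finset.disjoint_union_right]; exact ⟨d12.symm, d2s, d2t⟩)
      (by rw [hK, ← Finset.union_assoc, Finset.union_comm L2])
    have c3 := c.e2.2 (L1 ∪ {s}) (L2 ∪ {t}) (ne1.mono Finset.subset_union_left)
      (ne2.mono Finset.subset_union_left)
      (by simp only [Finset.disjoint_union_right, Finset.disjoint_union_left]
          exact ⟨⟨d12, d2s.symm⟩, d1t, dst⟩)
      (by rw [hK, Finset.union_union_union_comm])
    have c4 := c.e2.2 (L1 ∪ {t}) (L2 ∪ {s}) (ne1.mono Finset.subset_union_left)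
      (ne2.mono Finset.subset_union_left)
      (by simp only [Finset.disjoint_union_right, Finset.disjoint_union_left]
          exact ⟨⟨d12, d2t.symm⟩, d1s, dst.symm⟩)
      (by rw [hK, Finset.union_union_union_comm, Finset.union_comm {t}])
    have dlst : ∀ {L : Finset V}, Disjoint L {s} → Disjoint L {t} → Disjoint L ({s} ∪ {t}) :=
      fun h h' => Finset.disjoint_union_right.2 ⟨h, h'⟩
    rw [ee_union_right G _ (dlst d2s d2t), ee_union_right G _ dst] at c1
    rw [ee_union_right G _ (dlst d1s d1t), ee_union_right G _ dst] at c2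
    rw [ee_union_right G _ d2t, ee_union_left G _ d1s, ee_union_left G _ d1s] at c3
    rw [ee_union_right G _ d2s, ee_union_left G _ d1t, ee_union_left G _ d1t] at c4
    rw [ee_comm G L2 L1] at c2 deg2
    rw [ee_comm G {s} L1, ee_comm G {s} L2] at gs
    rw [ee_comm G {t} L1, ee_comm G {t} L2] at gt
    rw [ee_comm G {s} L2] at c3
    rw [ee_comm G {t} L2, ee_comm G {t} {s}] at c4
    have hle12 : ee G L1 L2 ≤ 1 := by
      rw [hL1, hL2, ee_image c.cf.inj c.cf'.inj c.h3]
      refine le_trans (ee_mono G' ?_ ?_) hle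
      · intro v hv
        obtain ⟨y, hy, rfl⟩ := Finset.mem_image.1 hv
        simpa using hy
      · intro v hv
        obtain ⟨y, hy, rfl⟩ := Finset.mem_image.1 hv
        simpa using hy
    have hne : ∀ {x y}, p' x ∈ Q1 → p' y ∈ Q2 → x ≠ y := by
      rintro x y hx hy rfl
      exact (Finset.disjoint_left.1 hd hx) hy
    by_cases h12 : ee G L1 L2 = 0
    · -- no edge between the two groups
      have hno : ∀ x y, p' x ∈ Q1 → p' y ∈ Q2 → ¬ G.Adj (p x) (p y) := fun x y hx hy =>
        (ee_eq_zero G).1 h12 _ ((m1 _).2 ⟨x, hx, rfl⟩) _ ((m2 _).2 ⟨y, hy, rfl⟩)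
      have get1 : ∀ r, 0 < ee G L1 {r} → ∃ a, p' a ∈ Q1 ∧ G.Adj r (p a) := by
        intro r hr
        obtain ⟨u, hu, v, hv, h⟩ := (ee_pos G).1 hr
        obtain ⟨y, hy, rfl⟩ := (m1 u).1 hu
        rw [Finset.mem_singleton] at hv
        subst hv
        exact ⟨y, hy, h.symm⟩
      have get2 : ∀ r, 0 < ee G L2 {r} → ∃ a, p' a ∈ Q2 ∧ G.Adj r (p a) := by
        intro r hr
        obtain ⟨u, hu, v, hv, h⟩ := (ee_pos G).1 hr
        obtain ⟨y, hy, rfl⟩ := (m2 u).1 hu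
        rw [Finset.mem_singleton] at hv
        subst hv
        exact ⟨y, hy, h.symm⟩
      obtain ⟨a1, ha1, sa1⟩ := get1 s (by omega)
      obtain ⟨a2, ha2, sa2⟩ := get2 s (by omega)
      obtain ⟨b1, hb1, tb1⟩ := get1 t (by omega)
      obtain ⟨b2, hb2, tb2⟩ := get2 t (by omega)
      obtain ⟨w, hwK, hwp, w1, w2⟩ := c.common (hne ha1 ha2) sa1 sa2
      rw [← hQ, Finset.mem_union] at hwK
      rcases hwK with hw | hw
      · exact c.case2 Q1 Q2 hd hQ hle hno a1 a2 b1 b2 ha1 ha2 hb1 hb2 sa1 sa2 tb1 tb2 w hw hwp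
          a2 ha2 w2
      · exact c.case2 Q2 Q1 hd.symm (by rw [Finset.union_comm, hQ]) (by rw [ee_comm]; exact hle)
          (fun x y hx hy h => hno y x hy hx h.symm) a2 a1 b2 b1 ha2 ha1 hb2 hb1 sa2 sa1 tb2 tb1
          w hw hwp a1 ha1 w1
    · obtain ⟨u, hu, v, hv, huv⟩ := (ee_pos G).1 (Nat.pos_of_ne_zero h12)
      obtain ⟨x, hx, rfl⟩ := (m1 u).1 hu
      obtain ⟨y, hy, rfl⟩ := (m2 v).1 hv
      rw [c.h3] at huv
      have nocross : ∀ w ∈ K', (∀ z, p' z ≠ w) → ∀ a b, p' a ∈ Q1 → p' b ∈ Q2 →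
          G'.Adj w (p' a) → G'.Adj w (p' b) → False := by
        intro w hw hwp a b ha hb h1 h2
        rw [← hQ, Finset.mem_union] at hw
        rcases hw with hw | hw
        · exact hwp _ (ee_unique G' hle hx hy hw hb huv h2).1
        · exact hwp _ (ee_unique G' hle hx hy ha hw huv h1.symm).2
      have hs0 : ee G L1 {s} = 0 ∨ ee G L2 {s} = 0 := by
        by_contra hcon
        rw [not_or] at hcon
        obtain ⟨u, hu, v, hv, h⟩ := (ee_pos G).1 (Nat.pos_of_ne_zero hcon.1)
        obtain ⟨u', hu', v', hv', h'⟩ := (ee_pos G).1 (Nat.pos_of_ne_zero hcon.2)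
        rw [Finset.mem_singleton] at hv hv'
        rw [hv] at h
        rw [hv'] at h'
        obtain ⟨a, ha, rfl⟩ := (m1 u).1 hu
        obtain ⟨b, hb, rfl⟩ := (m2 u').1 hu'
        obtain ⟨w, hwK, hwp, w1, w2⟩ := c.common (hne ha hb) h.symm h'.symm
        exact nocross w hwK hwp a b ha hb w1 w2
      have ht0 : ee G L1 {t} = 0 ∨ ee G L2 {t} = 0 := by
        by_contra hcon
        rw [not_or] at hcon
        obtain ⟨u, hu, v, hv, h⟩ := (ee_pos G).1 (Nat.pos_of_ne_zero hcon.1)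
        obtain ⟨u', hu', v', hv', h'⟩ := (ee_pos G).1 (Nat.pos_of_ne_zero hcon.2)
        rw [Finset.mem_singleton] at hv hv'
        rw [hv] at h
        rw [hv'] at h'
        obtain ⟨a, ha, rfl⟩ := (m1 u).1 hu
        obtain ⟨b, hb, rfl⟩ := (m2 u').1 hu'
        obtain ⟨w, hwK, hwp, w1, w2⟩ := c.swap.common (hne ha hb) h.symm h'.symm
        exact nocross w hwK hwp a b ha hb w1 w2
      omega

/-- isomorphism of cores, in parametrized form -/
def CoreIso {V V' Y : Type} (G : SimpleGraph V) (G' : SimpleGraph V')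
    (K : Finset V) (K' : Finset V') (p : Y → V) (p' : Y → V') : Prop :=
  ∃ (Z : Type) (f : Z → V) (f' : Z → V'), Function.Injective f ∧ Function.Injective f' ∧
    (∀ v, v ∈ K ↔ ∃ z, f z = v) ∧ (∀ v, v ∈ K' ↔ ∃ z, f' z = v) ∧
    (∀ a b, G.Adj (f a) (f b) ↔ G'.Adj (f' a) (f' b)) ∧ ∀ x, ∃ z, f z = p x ∧ f' z = p' x

theorem CF.image_sub {V Y : Type} [Fintype Y] {G : SimpleGraph V} {K : Finset V} {p : Y → V}
    (h : CF G K p) : Finset.univ.image p ⊆ K := by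
  intro v hv
  obtain ⟨y, -, rfl⟩ := Finset.mem_image.1 hv
  exact h.mem y

theorem CF.degL {V Y : Type} [Fintype Y] {G : SimpleGraph V} {K : Finset V} {p : Y → V}
    (h : CF G K p) : ee G (Finset.univ.image p) K = 2 * (Finset.univ.image p).card :=
  ee_sum G _ K 2 (by
    intro v hv
    obtain ⟨y, -, rfl⟩ := Finset.mem_image.1 hv
    exact h.deg2 y)

theorem CF.degR {V Y : Type} [Fintype Y] {G : SimpleGraph V} {K : Finset V} {p : Y → V}
    (h : CF G K p) :
    ee G (K \ Finset.univ.image p) K = 3 * (K \ Finset.univ.image p).card :=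
  ee_sum G _ K 3 (by
    intro v hv
    rw [Finset.mem_sdiff] at hv
    refine h.deg3 v hv.1 ?_
    rintro ⟨y, rfl⟩
    exact hv.2 (by simp))

theorem CF.rest {V Y : Type} [Fintype Y] {G : SimpleGraph V} {K : Finset V} {p : Y → V}
    (h : CF G K p) (he : E2 G K) (hl : Lev2 G) :
    (K \ Finset.univ.image p).card = 0 ∨ (K \ Finset.univ.image p).card = 2 := by
  have h1 := h.degL
  have h2 := h.degR
  have hu := Finset.union_sdiff_of_subset h.image_sub
  have hd : Disjoint (Finset.univ.image p) (K \ Finset.univ.image p) := Finset.disjoint_sdiff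
  have h3 := ee_union_left G K hd
  rw [hu] at h3
  obtain ⟨k, hk⟩ := ee_even G K
  have h4 := hl K he
  have h5 := Finset.card_union_of_disjoint hd
  rw [hu] at h5
  omega

theorem card_nbr {V Y : Type} [Fintype Y] {G : SimpleGraph V} {p : Y → V}
    (hp : Function.Injective p) (s : V) :
    (Finset.univ.filter (fun x => G.Adj s (p x))).card = ee G {s} (Finset.univ.image p) := by
  rw [ee_comm, ee_sum_image hp, Finset.card_filter]
  simp only [ee_single, G.adj_comm]

theorem Ctx.finish {V V' Y : Type} [Fintype Y] {G : SimpleGraph V} {G' : SimpleGraph V'}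
    {K : Finset V} {K' : Finset V'} {p : Y → V} {p' : Y → V'} {s t : V}
    (c : Ctx G G' K K' p p' s t) (s' t' : V') (hne : s' ≠ t')
    (hR : K' \ Finset.univ.image p' = {s'} ∪ {t'})
    (hst : ee G {s} {t} = ee G' {s'} {t'})
    (hcard : ee G' {s'} (Finset.univ.image p') + ee G' {s'} {t'} = 3)
    (hA : ∀ x, G.Adj s (p x) → G'.Adj s' (p' x)) : CoreIso G G' K K' p p' := by
  have hs' : ∀ x, p' x ≠ s' := by
    rintro x rfl
    have : p' x ∈ K' \ Finset.univ.image p' := by rw [hR]; simp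
    simp at this
  have ht' : ∀ x, p' x ≠ t' := by
    rintro x rfl
    have : p' x ∈ K' \ Finset.univ.image p' := by rw [hR]; simp
    simp at this
  have dst : Disjoint {s} ({t} : Finset V) := by simpa using c.ne
  have dst' : Disjoint {s'} ({t'} : Finset V') := by simpa using hne
  have h1 := c.count
  have hAeq : (Finset.univ.filter (fun x => G.Adj s (p x))) =
      (Finset.univ.filter (fun x => G'.Adj s' (p' x))) := by
    apply Finset.eq_of_subset_of_card_le
    · intro x
      simpa using hA x
    · rw [card_nbr c.cf.inj, card_nbr c.cf'.inj]
      omega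
  have hs : ∀ x, G.Adj (p x) s ↔ G'.Adj (p' x) s' := by
    intro x
    have := Finset.ext_iff.1 hAeq x
    simpa [G.adj_comm, G'.adj_comm] using this
  have ht : ∀ x, G.Adj (p x) t ↔ G'.Adj (p' x) t' := by
    intro x
    have h2 := c.count_leaf x
    rw [hR, ee_union_right G _ dst, ee_union_right G' _ dst'] at h2
    simp only [ee_single, hs x] at h2
    by_cases a : G.Adj (p x) t <;> by_cases b : G'.Adj (p' x) t' <;> simp [a, b] at h2 ⊢
  have hst2 : G.Adj s t ↔ G'.Adj s' t' := by
    simp only [ee_single] at hst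
    by_cases a : G.Adj s t <;> by_cases b : G'.Adj s' t' <;> simp [a, b] at hst ⊢
  refine ⟨Y ⊕ Bool, Sum.elim p (fun b => if b then s else t),
    Sum.elim p' (fun b => if b then s' else t'), ?_, ?_, ?_, ?_, ?_, fun x => ⟨Sum.inl x, rfl, rfl⟩⟩
  · rintro (x | _ | _) (y | _ | _) h <;> simp_all [c.ne, c.ne.symm, c.hs, c.ht, c.cf.inj.eq_iff,
      fun x => (c.hs x).symm, fun x => (c.ht x).symm]
  · rintro (x | _ | _) (y | _ | _) h <;> simp_all [hne.symm, c.cf'.inj.eq_iff,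
      fun x => (hs' x).symm, fun x => (ht' x).symm]
  · intro v
    rw [c.hK]
    simp [or_comm, eq_comm]
    tauto
  · intro v
    rw [← Finset.union_sdiff_of_subset c.cf'.image_sub, hR]
    simp [or_comm, eq_comm]
    tauto
  · rintro (x | _ | _) (y | _ | _)
    · exact c.h3 x y
    · exact ht x
    · exact hs x
    · simpa [G.adj_comm, G'.adj_comm] using ht y
    · simp
    · simpa [G.adj_comm, G'.adj_comm] using hst2
    · simpa [G.adj_comm, G'.adj_comm] using hs y
    · simpa using hst2
    · simp

theorem Ctx.iso {V V' Y : Type} [Fintype Y] {G : SimpleGraph V} {G' : SimpleGraph V'}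
    {K : Finset V} {K' : Finset V'} {p : Y → V} {p' : Y → V'} {s t : V}
    (c : Ctx G G' K K' p p' s t) : CoreIso G G' K K' p p' := by
  have hst1 : ee G {s} {t} ≤ 1 := by rw [ee_single]; split_ifs <;> omega
  have hall := c.count_all
  have hcard2 : (K' \ Finset.univ.image p').card = 2 := by
    rcases c.cf'.rest c.e2' c.lev with h | h
    · rw [Finset.card_eq_zero] at h
      rw [h] at hall
      have h0 : ee G' (Finset.univ.image p') ∅ = 0 := by simp [ee]
      omega
    · exact h
  obtain ⟨s', t', hne, hR0⟩ := Finset.card_eq_two.1 hcard2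
  have hR : K' \ Finset.univ.image p' = {s'} ∪ {t'} := by rw [hR0]; rfl
  have dst' : Disjoint {s'} ({t'} : Finset V') := by simpa using hne
  have hd : Disjoint (Finset.univ.image p') (K' \ Finset.univ.image p') := Finset.disjoint_sdiff
  have hu := Finset.union_sdiff_of_subset c.cf'.image_sub
  have hdegR := c.cf'.degR
  rw [hcard2] at hdegR
  have e1 := ee_union_right G' (K' \ Finset.univ.image p') hd
  rw [hu, hdegR, ee_comm G' _ (Finset.univ.image p')] at e1
  have e2 : ee G' (K' \ Finset.univ.image p') (K' \ Finset.univ.image p') =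
      2 * ee G' {s'} {t'} := by
    rw [hR, ee_union_left G' _ dst', ee_union_right G' _ dst', ee_union_right G' _ dst',
      ee_self, ee_self, ee_comm G' {t'}]
    omega
  have hst : ee G {s} {t} = ee G' {s'} {t'} := by omega
  have hmem : ∀ r, (r = s' ∨ r = t') → r ∈ K' ∧ ∀ x, p' x ≠ r := by
    intro r hr
    have : r ∈ K' \ Finset.univ.image p' := by rw [hR]; simpa using hr
    rw [Finset.mem_sdiff] at this
    refine ⟨this.1, ?_⟩
    rintro x rfl
    exact this.2 (by simp)
  have d3 : ∀ r, (r = s' ∨ r = t') → ee G' {r} (Finset.univ.image p') + ee G' {s'} {t'} = 3 := by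
    intro r hr
    have h3 := c.cf'.deg3 r (hmem r hr).1 (by rintro ⟨x, hx⟩; exact (hmem r hr).2 x hx)
    rw [← hu, ee_union_right G' _ hd, hR, ee_union_right G' _ dst'] at h3
    rcases hr with rfl | rfl
    · rw [ee_self] at h3; omega
    · rw [ee_self, ee_comm G' {r} {s'}] at h3; omega
  have pair : ∀ x y, x ≠ y → G.Adj s (p x) → G.Adj s (p y) →
      (G'.Adj s' (p' x) ∧ G'.Adj s' (p' y)) ∨ (G'.Adj t' (p' x) ∧ G'.Adj t' (p' y)) := by
    intro x y hxy hx hy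
    obtain ⟨w, hw, hwp, h1, h2⟩ := c.common hxy hx hy
    have : w ∈ K' \ Finset.univ.image p' := by
      rw [Finset.mem_sdiff]
      refine ⟨hw, fun h => ?_⟩
      obtain ⟨z, -, hz⟩ := Finset.mem_image.1 h
      exact hwp z hz
    rw [hR] at this
    simp only [Finset.mem_union, Finset.mem_singleton] at this
    rcases this with rfl | rfl
    · exact Or.inl ⟨h1, h2⟩
    · exact Or.inr ⟨h1, h2⟩
  have hAcard := card_nbr (G := G) c.cf.inj s
  have hc := c.count
  have claim : (∀ x, G.Adj s (p x) → G'.Adj s' (p' x)) ∨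
      (∀ x, G.Adj s (p x) → G'.Adj t' (p' x)) := by
    have memA : ∀ x, x ∈ (Finset.univ.filter (fun x => G.Adj s (p x))) ↔ G.Adj s (p x) := by
      simp
    rcases (by omega : ee G {s} {t} = 1 ∨ ee G {s} {t} = 0) with h | h
    · obtain ⟨x, y, hxy, hA⟩ := Finset.card_eq_two.1 (by omega :
        (Finset.univ.filter (fun x => G.Adj s (p x))).card = 2)
      simp only [hA, Finset.mem_insert, Finset.mem_singleton] at memA
      rcases pair x y hxy ((memA x).1 (by simp)) ((memA y).1 (by simp)) with h | h
      · left
        intro z hz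
        rcases (memA z).2 hz with rfl | rfl
        exacts [h.1, h.2]
      · right
        intro z hz
        rcases (memA z).2 hz with rfl | rfl
        exacts [h.1, h.2]
    · obtain ⟨x, y, z, hxy, hxz, hyz, hA⟩ := Finset.card_eq_three.1 (by omega :
        (Finset.univ.filter (fun x => G.Adj s (p x))).card = 3)
      simp only [hA, Finset.mem_insert, Finset.mem_singleton] at memA
      have hx := (memA x).1 (by simp)
      have hy := (memA y).1 (by simp)
      have hz := (memA z).1 (by simp)
      have q1 := pair x y hxy hx hy
      have q2 := pair x z hxz hx hz
      have q3 := pair y z hyz hy hz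
      have : (G'.Adj s' (p' x) ∧ G'.Adj s' (p' y) ∧ G'.Adj s' (p' z)) ∨
        (G'.Adj t' (p' x) ∧ G'.Adj t' (p' y) ∧ G'.Adj t' (p' z)) := by tauto
      rcases this with h | h
      · left
        intro u hu
        rcases (memA u).2 hu with rfl | rfl | rfl
        exacts [h.1, h.2.1, h.2.2]
      · right
        intro u hu
        rcases (memA u).2 hu with rfl | rfl | rfl
        exacts [h.1, h.2.1, h.2.2]
  rcases claim with h | h
  · exact c.finish s' t' hne hR hst (d3 s' (Or.inl rfl)) h
  · exact c.finish t' s' hne.symm (by rw [hR, Finset.union_comm]) (by rw [hst, ee_comm])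
      (by rw [ee_comm G' {t'} {s'}]; exact d3 t' (Or.inr rfl)) h

/-- The cherry-free case. -/
theorem core_iso {V V' Y : Type} [Fintype Y] {G : SimpleGraph V} {G' : SimpleGraph V'}
    {K : Finset V} {K' : Finset V'} {p : Y → V} {p' : Y → V'}
    (cf : CF G K p) (cf' : CF G' K' p') (hl : Lev2 G) (hl' : Lev2 G') (ho : One2 G)
    (hB : ∀ B, E2 G B → B ⊆ K)
    (h3 : ∀ x y, G.Adj (p x) (p y) ↔ G'.Adj (p' x) (p' y))
    (h4 : ∀ x y, x ≠ y → ¬ G.Adj (p x) (p y) → (∃ w, G.Adj w (p x) ∧ G.Adj w (p y)) →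
      ∃ w ∈ K', G'.Adj w (p' x) ∧ G'.Adj w (p' y)) : CoreIso G G' K K' p p' := by
  have e2 := cf.bridgeless ho hB
  have hu := Finset.union_sdiff_of_subset cf.image_sub
  rcases cf.rest e2 hl with h | h
  · rw [Finset.card_eq_zero] at h
    rw [h, Finset.union_empty] at hu
    have hK' : Finset.univ.image p' = K' := by
      by_contra hne
      have hd : Disjoint (Finset.univ.image p') (K' \ Finset.univ.image p') :=
        Finset.disjoint_sdiff
      have hu' := Finset.union_sdiff_of_subset cf'.image_sub
      have hn : (K' \ Finset.univ.image p').Nonempty := by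
        rw [Finset.sdiff_nonempty]
        exact fun h => hne (subset_antisymm cf'.image_sub h)
      have hY : 0 < (Finset.univ.image p).card := by rw [hu]; have := e2.1; omega
      have hcc : (Finset.univ.image p).card = (Finset.univ.image p').card := by
        rw [Finset.card_image_of_injective _ cf.inj, Finset.card_image_of_injective _ cf'.inj]
      have h5 := cf'.conn _ _ (Finset.card_pos.1 (hcc ▸ hY)) hn hd hu'
      have h6 := cf.degL
      have h7 := cf'.degL
      have h8 := ee_image cf.inj cf'.inj h3 Finset.univ Finset.univ
      have h9 := ee_union_right G' (Finset.univ.image p') hd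
      rw [hu'] at h9
      rw [hu] at h6 h8
      rw [hu] at hcc
      omega
    refine ⟨Y, p, p', cf.inj, cf'.inj, ?_, ?_, h3, fun x => ⟨x, rfl, rfl⟩⟩
    · intro v; rw [← hu]; simp
    · intro v; rw [← hK']; simp
  · obtain ⟨s, t, hne, hR⟩ := Finset.card_eq_two.1 h
    have hmem : ∀ r, (r = s ∨ r = t) → ∀ x, p x ≠ r := by
      rintro r hr x rfl
      have : p x ∈ K \ Finset.univ.image p := by rw [hR]; simpa using hr
      simp at this
    exact Ctx.iso (s := s) (t := t) ⟨cf, cf', e2, hl', hne, hmem s (Or.inl rfl),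
      hmem t (Or.inr rfl), (by rw [hR] at hu; exact hu.symm), h3, h4⟩

/-- networks with at least one edge -/
structure Net {V Y : Type} [Fintype V] (G : SimpleGraph V) (leaf : Y → V) : Prop where
  conn : G.Connected
  inj : Function.Injective leaf
  d1 : ∀ x, ee G {leaf x} Finset.univ = 1
  d3 : ∀ v, v ∉ Set.range leaf → ee G {v} Finset.univ = 3

theorem closed_univ {V : Type} {G : SimpleGraph V} (h : G.Connected) (S : Set V)
    (hn : S.Nonempty) (hc : ∀ u v, u ∈ S → G.Adj u v → v ∈ S) (v : V) : v ∈ S := by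
  obtain ⟨u, hu⟩ := hn
  obtain ⟨w⟩ := h.preconnected u v
  induction w with
  | nil => exact hu
  | cons hadj _ ih => exact ih (hc _ _ hu hadj)

theorem Net.uniq {V Y : Type} [Fintype V] {G : SimpleGraph V} {leaf : Y → V} (h : Net G leaf)
    (x : Y) {u v : V} (hu : G.Adj (leaf x) u) (hv : G.Adj (leaf x) v) : u = v :=
  (ee_unique G (h.d1 x).le (by simp) (by simp) (by simp) (by simp) hu hv).2

theorem Net.parent {V Y : Type} [Fintype V] {G : SimpleGraph V} {leaf : Y → V} (h : Net G leaf)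
    (x : Y) : ∃ q, G.Adj (leaf x) q := by
  obtain ⟨u, hu, v, -, huv⟩ := (ee_pos G).1 (by rw [h.d1 x]; omega : 0 < ee G {leaf x} Finset.univ)
  rw [Finset.mem_singleton] at hu
  subst hu
  exact ⟨v, huv⟩

theorem E2.two_nbr {V : Type} {G : SimpleGraph V} {B : Finset V} (h : E2 G B) {v : V}
    (hv : v ∈ B) : 2 ≤ ee G {v} B := by
  have hc := h.1
  have := h.2 {v} (B.erase v) (by simp)
    (Finset.card_pos.1 (by rw [Finset.card_erase_of_mem hv]; omega)) (by simp)
    (by rw [← Finset.insert_eq, Finset.insert_erase hv])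
  exact this.trans (ee_mono G subset_rfl (Finset.erase_subset _ _))

theorem Net.notleaf {V Y : Type} [Fintype V] {G : SimpleGraph V} {leaf : Y → V} (h : Net G leaf)
    {B : Finset V} (hB : E2 G B) {v : V} (hv : v ∈ B) (x : Y) : leaf x ≠ v := by
  rintro rfl
  have := hB.two_nbr hv
  have := ee_mono G (subset_refl {leaf x}) (Finset.subset_univ B)
  have := h.d1 x
  omega

theorem Net.nonadj {V Y : Type} [Fintype V] {G : SimpleGraph V} {leaf : Y → V} (h : Net G leaf)
    {B : Finset V} (hB : E2 G B) (x y : Y) : ¬ G.Adj (leaf x) (leaf y) := by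
  intro hadj
  obtain ⟨b, hb⟩ := Finset.card_pos.1 (by have := hB.1; omega : 0 < B.card)
  have := closed_univ h.conn {leaf x, leaf y} ⟨leaf x, by simp⟩ (by
    rintro u v (rfl | rfl) huv
    · exact Or.inr (h.uniq x huv hadj)
    · exact Or.inl (h.uniq y huv hadj.symm)) b
  rcases this with rfl | hy
  · exact h.notleaf hB hb x rfl
  · exact h.notleaf hB hb y (by rw [hy])

theorem Net.cf {V Y : Type} [Fintype V] [Fintype Y] {G : SimpleGraph V} {leaf : Y → V}
    (h : Net G leaf) (hna : ∀ x y, ¬ G.Adj (leaf x) (leaf y)) (p : Y → V)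
    (hp : ∀ x, G.Adj (leaf x) (p x)) (hinj : Function.Injective p) :
    CF G (Finset.univ \ Finset.univ.image leaf) p := by
  have hd : Disjoint (Finset.univ.image leaf) (Finset.univ \ Finset.univ.image leaf) :=
    Finset.disjoint_sdiff
  have hu : Finset.univ.image leaf ∪ (Finset.univ \ Finset.univ.image leaf) = Finset.univ :=
    Finset.union_sdiff_of_subset (Finset.subset_univ _)
  have memK : ∀ v, v ∈ Finset.univ \ Finset.univ.image leaf ↔ ∀ x, leaf x ≠ v := by
    intro v; simp
  have hpx : ∀ x, p x ∉ Set.range leaf := by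
    rintro x ⟨y, hy⟩
    exact hna x y (hy ▸ hp x)
  refine ⟨hinj, ?_, ?_, ?_, ?_⟩
  · intro x
    rw [memK]
    exact fun y hy => hpx x ⟨y, hy⟩
  · intro x
    have h3 := h.d3 (p x) (hpx x)
    rw [← hu, ee_union_right G _ hd] at h3
    have : ee G {p x} (Finset.univ.image leaf) = 1 := by
      rw [← card_nbr h.inj, Finset.card_eq_one]
      refine ⟨x, ?_⟩
      ext y
      simp only [Finset.mem_filter, Finset.mem_univ, true_and, Finset.mem_singleton]
      constructor
      · intro hy
        exact hinj (h.uniq y (hp y) hy.symm)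
      · rintro rfl
        exact (hp y).symm
    omega
  · intro v hv hvp
    rw [memK] at hv
    have h3 := h.d3 v (by rintro ⟨x, hx⟩; exact hv x hx)
    rw [← hu, ee_union_right G _ hd] at h3
    have : ee G {v} (Finset.univ.image leaf) = 0 := by
      rw [ee_eq_zero]
      intro u hu w hw huw
      rw [Finset.mem_singleton] at hu
      subst hu
      obtain ⟨x, -, rfl⟩ := Finset.mem_image.1 hw
      exact hvp ⟨x, h.uniq x (hp x) huw.symm⟩
    omega
  · intro T U hT hU hd2 hTU
    by_contra hlt
    have h0 : ee G T U = 0 := by omega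
    rw [ee_eq_zero] at h0
    obtain ⟨b, hb⟩ := hU
    have hbK : ∀ x, leaf x ≠ b := (memK b).1 (hTU ▸ Finset.mem_union_right _ hb)
    have := closed_univ h.conn {v | v ∈ T ∨ ∃ x, v = leaf x ∧ p x ∈ T}
      ⟨hT.choose, Or.inl hT.choose_spec⟩ (by
        rintro u v (hu | ⟨x, rfl, hx⟩) huv
        · by_cases hv : ∃ x, leaf x = v
          · obtain ⟨x, rfl⟩ := hv
            exact Or.inr ⟨x, rfl, h.uniq x (hp x) huv.symm ▸ hu⟩
          · have hv' : v ∈ T ∪ U := by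
              rw [hTU, memK]
              exact fun x hx => hv ⟨x, hx⟩
            rcases Finset.mem_union.1 hv' with hv' | hv'
            · exact Or.inl hv'
            · exact absurd huv (h0 u hu v hv')
        · left
          rw [h.uniq x huv (hp x)]
          exact hx) b
    rcases this with hbT | ⟨x, hx, -⟩
    · exact Finset.disjoint_left.1 hd2 hbT hb
    · exact hbK x hx.symm

theorem dist_leaf {V : Type} {G : SimpleGraph V} (hc : G.Connected) {u q v : V}
    (hq : G.Adj u q) (hun : ∀ w, G.Adj u w → w = q) (hv : v ≠ u) :
    G.dist u v = G.dist q v + 1 := by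
  apply le_antisymm
  · have := hc.dist_triangle (u := u) (v := q) (w := v)
    rw [dist_eq_one_iff_adj.2 hq] at this
    omega
  · obtain ⟨w, hw⟩ := hc.exists_walk_length_eq_dist u v
    cases w with
    | nil => exact absurd rfl hv
    | cons hadj w' =>
      have := hun _ hadj
      subst this
      rw [← hw, SimpleGraph.Walk.length_cons]
      have := SimpleGraph.dist_le w'
      omega

theorem dist_two {V : Type} {G : SimpleGraph V} (hc : G.Connected) {u v : V}
    (h : G.dist u v = 2) : ∃ w, G.Adj w u ∧ G.Adj w v := by
  obtain ⟨w, hw⟩ := hc.exists_walk_length_eq_dist u v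
  rw [h] at hw
  cases w with
  | nil => simp at hw
  | cons h1 w1 =>
    cases w1 with
    | nil => simp at hw
    | cons h2 w2 =>
      cases w2 with
      | nil => exact ⟨_, h1.symm, h2⟩
      | cons h3 w3 => simp at hw

theorem two_dist {V : Type} {G : SimpleGraph V} (hc : G.Connected) {u v w : V} (hne : u ≠ v)
    (hna : ¬ G.Adj u v) (h1 : G.Adj w u) (h2 : G.Adj w v) : G.dist u v = 2 := by
  have a1 := hc.dist_triangle (u := u) (v := w) (w := v)
  rw [dist_eq_one_iff_adj.2 h1.symm, dist_eq_one_iff_adj.2 h2] at a1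
  have a2 := hc.pos_dist_of_ne hne
  have a3 : G.dist u v ≠ 1 := fun h => hna (dist_eq_one_iff_adj.1 h)
  omega

theorem iso_param {V V' Z : Type} {G : SimpleGraph V} {G' : SimpleGraph V'} (F : Z → V)
    (F' : Z → V') (h : Function.Bijective F) (h' : Function.Bijective F')
    (ha : ∀ a b, G.Adj (F a) (F b) ↔ G'.Adj (F' a) (F' b)) :
    ∃ φ : G ≃g G', ∀ z, φ (F z) = F' z := by
  refine ⟨⟨(Equiv.ofBijective F h).symm.trans (Equiv.ofBijective F' h'), ?_⟩, ?_⟩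
  · intro a b
    obtain ⟨a, rfl⟩ := h.2 a
    obtain ⟨b, rfl⟩ := h.2 b
    simp only [Equiv.trans_apply, Equiv.ofBijective_symm_apply_apply, Equiv.ofBijective_apply]
    exact (ha a b).symm
  · intro z
    change (Equiv.ofBijective F' h') ((Equiv.ofBijective F h).symm (F z)) = F' z
    rw [Equiv.ofBijective_symm_apply_apply, Equiv.ofBijective_apply]

/-- the theorem for networks without cherries -/
theorem nocherry {V V' Y : Type} [Fintype V] [Fintype V'] [Fintype Y]
    {G : SimpleGraph V} {G' : SimpleGraph V'} {leaf : Y → V} {leaf' : Y → V'}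
    (h : Net G leaf) (h' : Net G' leaf') (hl : Lev2 G) (hl' : Lev2 G') (ho : One2 G)
    (hd : ∀ x y, G.dist (leaf x) (leaf y) = G'.dist (leaf' x) (leaf' y))
    (hc : ∀ x y, G.dist (leaf x) (leaf y) ≠ 2) :
    ∃ φ : G ≃g G', ∀ x, φ (leaf x) = leaf' x := by
  obtain ⟨B, hB⟩ := ho.1
  have hna := h.nonadj hB
  have hna' : ∀ x y, ¬ G'.Adj (leaf' x) (leaf' y) := by
    intro x y hxy
    rw [← dist_eq_one_iff_adj, ← hd, dist_eq_one_iff_adj] at hxy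
    exact hna x y hxy
  choose p hp using h.parent
  choose p' hp' using h'.parent
  have inj : Function.Injective p := by
    intro x y hxy
    by_contra hne
    refine hc x y (two_dist h.conn (fun e => hne (h.inj e)) (hna x y) (hp x).symm ?_)
    rw [hxy]
    exact (hp y).symm
  have inj' : Function.Injective p' := by
    intro x y hxy
    by_contra hne
    refine hc x y ((hd x y).trans
      (two_dist h'.conn (fun e => hne (h'.inj e)) (hna' x y) (hp' x).symm ?_))
    rw [hxy]
    exact (hp' y).symm
  have cf := h.cf hna p hp inj
  have cf' := h'.cf hna' p' hp' inj'
  have hdp : ∀ x y, x ≠ y → G.dist (p x) (p y) = G'.dist (p' x) (p' y) := by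
    intro x y hne
    have e1 := dist_leaf h.conn (hp x) (fun w hw => h.uniq x hw (hp x))
      (v := leaf y) (fun e => hne (h.inj e).symm)
    have e2 := dist_leaf h.conn (hp y) (fun w hw => h.uniq y hw (hp y))
      (v := p x) (fun e => hna x y (e ▸ hp x))
    have e1' := dist_leaf h'.conn (hp' x) (fun w hw => h'.uniq x hw (hp' x))
      (v := leaf' y) (fun e => hne (h'.inj e).symm)
    have e2' := dist_leaf h'.conn (hp' y) (fun w hw => h'.uniq y hw (hp' y))
      (v := p' x) (fun e => hna' x y (e ▸ hp' x))
    have := hd x y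
    rw [dist_comm, dist_comm (u := p y)] at e2
    rw [dist_comm, dist_comm (u := p' y)] at e2'
    omega
  have h3 : ∀ x y, G.Adj (p x) (p y) ↔ G'.Adj (p' x) (p' y) := by
    intro x y
    by_cases hne : x = y
    · subst hne; simp
    · rw [← dist_eq_one_iff_adj, ← dist_eq_one_iff_adj, hdp x y hne]
  have hci : CoreIso G G' (Finset.univ \ Finset.univ.image leaf)
      (Finset.univ \ Finset.univ.image leaf') p p' := by
    refine core_iso cf cf' hl hl' ho ?_ h3 ?_
    · intro B hB v hv
      have := h.notleaf hB hv
      simpa using this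
    · rintro x y hne hna2 ⟨w, hw1, hw2⟩
      have := two_dist h.conn (fun e => hne (inj e)) hna2 hw1 hw2
      rw [hdp x y hne] at this
      obtain ⟨w', h1, h2⟩ := dist_two h'.conn this
      refine ⟨w', ?_, h1, h2⟩
      simp only [Finset.mem_sdiff, Finset.mem_univ, true_and, Finset.mem_image, not_exists]
      rintro z rfl
      exact hne (inj' (h'.uniq z h1 h2))
  obtain ⟨Z, f, f', fi, fi', fK, fK', fadj, fp⟩ := hci
  have nf : ∀ x z, leaf x ≠ f z := by
    intro x z
    have := (fK (f z)).2 ⟨z, rfl⟩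
    simp only [Finset.mem_sdiff, Finset.mem_univ, true_and, Finset.mem_image, not_exists] at this
    exact this x
  have nf' : ∀ x z, leaf' x ≠ f' z := by
    intro x z
    have := (fK' (f' z)).2 ⟨z, rfl⟩
    simp only [Finset.mem_sdiff, Finset.mem_univ, true_and, Finset.mem_image, not_exists] at this
    exact this x
  have adjx : ∀ x z, G.Adj (leaf x) (f z) ↔ G'.Adj (leaf' x) (f' z) := by
    intro x z
    obtain ⟨z0, hz0, hz0'⟩ := fp x
    have i1 : G.Adj (leaf x) (f z) ↔ z = z0 := by
      constructor
      · intro ha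
        exact fi ((h.uniq x ha (hp x)).trans hz0.symm)
      · rintro rfl
        rw [hz0]; exact hp x
    have i2 : G'.Adj (leaf' x) (f' z) ↔ z = z0 := by
      constructor
      · intro ha
        exact fi' ((h'.uniq x ha (hp' x)).trans hz0'.symm)
      · rintro rfl
        rw [hz0']; exact hp' x
    rw [i1, i2]
  obtain ⟨φ, hφ⟩ := iso_param (G := G) (G' := G') (Sum.elim leaf f) (Sum.elim leaf' f')
    ⟨h.inj.sumElim fi nf, by
      intro v
      by_cases hv : ∃ x, leaf x = v
      · obtain ⟨x, rfl⟩ := hv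
        exact ⟨Sum.inl x, rfl⟩
      · obtain ⟨z, hz⟩ := (fK v).1 (by simpa using hv)
        exact ⟨Sum.inr z, hz⟩⟩
    ⟨h'.inj.sumElim fi' nf', by
      intro v
      by_cases hv : ∃ x, leaf' x = v
      · obtain ⟨x, rfl⟩ := hv
        exact ⟨Sum.inl x, rfl⟩
      · obtain ⟨z, hz⟩ := (fK' v).1 (by simpa using hv)
        exact ⟨Sum.inr z, hz⟩⟩
    (by
      rintro (x | z) (y | w)
      · exact iff_of_false (hna x y) (hna' x y)
      · exact adjx x w
      · simpa [G.adj_comm, G'.adj_comm] using adjx y z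
      · exact fadj z w)
  exact ⟨φ, fun x => hφ (Sum.inl x)⟩

theorem ee_comap {V V1 : Type} {G : SimpleGraph V} {ι : V1 → V} (hi : Function.Injective ι)
    (A B : Finset V1) : ee (G.comap ι) A B = ee G (A.image ι) (B.image ι) := by
  unfold ee
  rw [Finset.sum_image (fun a _ b _ hab => hi hab)]
  refine Finset.sum_congr rfl fun a _ => ?_
  rw [Finset.sum_image (fun a _ b _ hab => hi hab)]
  rfl

theorem E2_comap {V V1 : Type} {G : SimpleGraph V} {ι : V1 → V} (hi : Function.Injective ι)
    (B : Finset V1) : E2 (G.comap ι) B ↔ E2 G (B.image ι) := by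
  unfold E2
  rw [Finset.card_image_of_injective _ hi]
  refine and_congr_right fun _ => ⟨?_, ?_⟩
  · intro h T U hT hU hd hTU
    obtain ⟨T, -, rfl⟩ := Finset.subset_image_iff.1
      (show T ⊆ B.image ι from hTU ▸ Finset.subset_union_left)
    obtain ⟨U, -, rfl⟩ := Finset.subset_image_iff.1
      (show U ⊆ B.image ι from hTU ▸ Finset.subset_union_right)
    rw [← ee_comap hi]
    refine h T U (Finset.image_nonempty.1 hT) (Finset.image_nonempty.1 hU)
      ((Finset.disjoint_image hi).1 hd) ?_
    rw [← Finset.image_union] at hTU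
    exact Finset.image_injective hi hTU
  · intro h T U hT hU hd hTU
    rw [ee_comap hi]
    exact h _ _ (hT.image _) (hU.image _) ((Finset.disjoint_image hi).2 hd)
      (by rw [← Finset.image_union, hTU])

theorem reduce {V Y : Type} [Fintype V] {G : SimpleGraph V} {leaf : Y → V} (h : Net G leaf)
    (hna : ∀ x y, ¬ G.Adj (leaf x) (leaf y)) {x y : Y} (hne : x ≠ y) {q : V}
    (hx : G.Adj q (leaf x)) (hy : G.Adj q (leaf y)) :
    ∃ (V1 : Type) (_ : Fintype V1) (ι : V1 → V) (leaf1 : {z : Y // z ≠ x} → V1),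
      Function.Injective ι ∧ (∀ v, (∃ a, ι a = v) ↔ v ≠ leaf x ∧ v ≠ leaf y) ∧
      (∀ z, ι (leaf1 z) = if z.1 = y then q else leaf z.1) ∧ Net (G.comap ι) leaf1 ∧
      (Lev2 G → Lev2 (G.comap ι)) ∧ (One2 G → One2 (G.comap ι)) ∧
      ∀ a b, (G.comap ι).dist a b = G.dist (ι a) (ι b) := by
  have qx : ∀ v, G.Adj v (leaf x) → v = q := fun v hv => h.uniq x hv.symm hx.symm
  have qy : ∀ v, G.Adj v (leaf y) → v = q := fun v hv => h.uniq y hv.symm hy.symm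
  have hql : ∀ z, leaf z ≠ q := by
    rintro z rfl
    exact hna _ _ hx
  have hxy : leaf x ≠ leaf y := fun e => hne (h.inj e)
  let V1 := {v : V // v ≠ leaf x ∧ v ≠ leaf y}
  let ι : V1 → V := Subtype.val
  have hi : Function.Injective ι := Subtype.val_injective
  have hr : ∀ v, (∃ a, ι a = v) ↔ v ≠ leaf x ∧ v ≠ leaf y := by
    intro v
    constructor
    · rintro ⟨a, rfl⟩
      exact a.2
    · intro hv
      exact ⟨⟨v, hv⟩, rfl⟩
  have hex : ∀ z : {z : Y // z ≠ x}, ∃ a, ι a = if z.1 = y then q else leaf z.1 := by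
    intro z
    rw [hr]
    split_ifs with hz
    · exact ⟨(hql x).symm, (hql y).symm⟩
    · exact ⟨fun e => z.2 (h.inj e), fun e => hz (h.inj e)⟩
  choose leaf1 hl1 using hex
  obtain ⟨q1, hq1⟩ := (hr q).2 ⟨(hql x).symm, (hql y).symm⟩
  clear_value V1 ι
  let fV1 : Fintype V1 := Fintype.ofInjective ι hi
  have hret : ∀ v, ∃ a, (v ≠ leaf x ∧ v ≠ leaf y → ι a = v) ∧
      (v = leaf x ∨ v = leaf y → ι a = q) := by
    intro v
    by_cases hv : v ≠ leaf x ∧ v ≠ leaf y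
    · obtain ⟨a, ha⟩ := (hr v).2 hv
      exact ⟨a, fun _ => ha, by rintro (e | e); exacts [absurd e hv.1, absurd e hv.2]⟩
    · exact ⟨q1, fun hv' => absurd hv' hv, fun _ => hq1⟩
  choose r hr1 hr2 using hret
  have rι : ∀ a, r (ι a) = a := fun a => hi (hr1 _ ((hr _).1 ⟨a, rfl⟩))
  have half : ∀ u v, G.Adj u v → (u = leaf x ∨ u = leaf y) → r u = r v := by
    intro u v huv hu
    have hv : v = q := by
      rcases hu with rfl | rfl
      · exact qx v huv.symm
      · exact qy v huv.symm
    subst hv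
    refine hi ?_
    rw [hr2 u hu, hr1 v ⟨(hql x).symm, (hql y).symm⟩]
  have radj : ∀ u v, G.Adj u v → r u = r v ∨ (G.comap ι).Adj (r u) (r v) := by
    intro u v huv
    by_cases hu : u = leaf x ∨ u = leaf y
    · exact Or.inl (half u v huv hu)
    by_cases hv : v = leaf x ∨ v = leaf y
    · exact Or.inl (half v u huv.symm hv).symm
    right
    rw [SimpleGraph.comap_adj, hr1 u (not_or.1 hu), hr1 v (not_or.1 hv)]
    exact huv
  have rwalk : ∀ u v (w : G.Walk u v), ∃ w1 : (G.comap ι).Walk (r u) (r v),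
      w1.length ≤ w.length := by
    intro u v w
    induction w with
    | nil => exact ⟨SimpleGraph.Walk.nil, le_rfl⟩
    | @cons a b c hadj w ih =>
      obtain ⟨w1, hw1⟩ := ih
      rcases radj _ _ hadj with e | e
      · rw [e]
        exact ⟨w1, by rw [SimpleGraph.Walk.length_cons]; omega⟩
      · exact ⟨SimpleGraph.Walk.cons e w1, by
          rw [SimpleGraph.Walk.length_cons, SimpleGraph.Walk.length_cons]; omega⟩
  have hconn : (G.comap ι).Connected := by
    have : Nonempty V1 := ⟨q1⟩
    refine ⟨fun a b => ?_⟩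
    obtain ⟨w⟩ := h.conn.preconnected (ι a) (ι b)
    obtain ⟨w1, -⟩ := rwalk _ _ w
    rw [rι, rι] at w1
    exact ⟨w1⟩
  have hdist : ∀ a b, (G.comap ι).dist a b = G.dist (ι a) (ι b) := by
    intro a b
    apply le_antisymm
    · obtain ⟨w, hw⟩ := h.conn.exists_walk_length_eq_dist (ι a) (ι b)
      obtain ⟨w1, hw1⟩ := rwalk _ _ w
      have := (SimpleGraph.dist_le w1).trans hw1
      rw [rι, rι] at this
      omega
    · obtain ⟨w, hw⟩ := hconn.exists_walk_length_eq_dist a b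
      have := SimpleGraph.dist_le (w.map (⟨ι, fun hh => hh⟩ : G.comap ι →g G))
      rw [SimpleGraph.Walk.length_map, hw] at this
      exact this
  have split : ∀ u, ee G {u} Finset.univ =
      ee G {u} {leaf x} + ee G {u} {leaf y} + ee G {u} (Finset.univ.image ι) := by
    intro u
    have e : (Finset.univ : Finset V) = ({leaf x} ∪ {leaf y}) ∪ Finset.univ.image ι := by
      ext v
      have := hr v
      simp only [Finset.mem_univ, Finset.mem_union, Finset.mem_singleton, Finset.mem_image,
        true_and, true_iff]
      tauto
    have d1 : Disjoint ({leaf x} : Finset V) {leaf y} := by simpa using hxy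
    have d2 : Disjoint (({leaf x} : Finset V) ∪ {leaf y}) (Finset.univ.image ι) := by
      rw [Finset.disjoint_left]
      intro v hv hv'
      obtain ⟨a, -, rfl⟩ := Finset.mem_image.1 hv'
      have := (hr _).1 ⟨a, rfl⟩
      simp only [Finset.mem_union, Finset.mem_singleton] at hv
      tauto
    rw [e, ee_union_right G _ d2, ee_union_right G _ d1]
  have deg : ∀ a, ι a ≠ q →
      ee (G.comap ι) {a} Finset.univ = ee G {ι a} Finset.univ := by
    intro a ha
    rw [split, ee_comap hi, Finset.image_singleton, ee_single, ee_single,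
      if_neg (fun hh => ha (qx _ hh)), if_neg (fun hh => ha (qy _ hh))]
    omega
  refine ⟨V1, fV1, ι, leaf1, hi, hr, hl1, ⟨hconn, ?_, ?_, ?_⟩, ?_, ?_, hdist⟩
  · intro z w hzw
    have e : (if z.1 = y then q else leaf z.1) = if w.1 = y then q else leaf w.1 := by
      rw [← hl1, ← hl1, hzw]
    split_ifs at e with h1 h2 h2
    · exact Subtype.ext (h1.trans h2.symm)
    · exact absurd e.symm (hql _)
    · exact absurd e (hql _)
    · exact Subtype.ext (h.inj e)
  · intro z
    by_cases hz : z.1 = y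
    · have e := hl1 z
      rw [if_pos hz] at e
      have h3 := h.d3 q (by rintro ⟨w, hw⟩; exact hql w hw)
      rw [split, ee_single, ee_single, if_pos hx, if_pos hy] at h3
      rw [ee_comap hi, Finset.image_singleton, e]
      omega
    · have e := hl1 z
      rw [if_neg hz] at e
      rw [deg _ (by rw [e]; exact hql _), e]
      exact h.d1 _
  · intro a ha
    have hq : ι a ≠ q := by
      intro e
      refine ha ⟨⟨y, hne.symm⟩, hi ?_⟩
      rw [hl1, if_pos rfl, e]
    rw [deg a hq]
    refine h.d3 _ ?_
    rintro ⟨w, hw⟩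
    have h2 := (hr _).1 ⟨a, rfl⟩
    have hwx : w ≠ x := by rintro rfl; exact h2.1 hw.symm
    have hwy : w ≠ y := by rintro rfl; exact h2.2 hw.symm
    refine ha ⟨⟨w, hwx⟩, hi ?_⟩
    rw [hl1, if_neg hwy, hw]
  · intro hl B hB
    have := hl _ ((E2_comap hi B).1 hB)
    rwa [← ee_comap hi, Finset.card_image_of_injective _ hi] at this
  · have lift : ∀ B, E2 G B → ∃ B1 : Finset V1, B1.image ι = B := by
      intro B hB
      have : B ⊆ Finset.univ.image ι := by
        intro v hv
        obtain ⟨a, ha⟩ := (hr v).2 ⟨(h.notleaf hB hv x).symm, (h.notleaf hB hv y).symm⟩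
        exact Finset.mem_image.2 ⟨a, Finset.mem_univ _, ha⟩
      obtain ⟨B1, -, hB1⟩ := Finset.subset_image_iff.1 this
      exact ⟨B1, hB1⟩
    rintro ⟨⟨B, hB⟩, ho⟩
    constructor
    · obtain ⟨B1, rfl⟩ := lift B hB
      exact ⟨B1, (E2_comap hi B1).2 hB⟩
    · intro B1 B2 h1 h2
      obtain ⟨C, hC, s1, s2⟩ := ho _ _ ((E2_comap hi B1).1 h1) ((E2_comap hi B2).1 h2)
      obtain ⟨C1, rfl⟩ := lift C hC
      exact ⟨C1, (E2_comap hi C1).2 hC, (Finset.image_subset_image_iff hi).1 s1,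
        (Finset.image_subset_image_iff hi).1 s2⟩

theorem main_net : ∀ (n : ℕ) {V V' Y : Type} [Fintype V] [Fintype V'] [Fintype Y]
    {G : SimpleGraph V} {G' : SimpleGraph V'} {leaf : Y → V} {leaf' : Y → V'},
    Fintype.card Y = n → Net G leaf → Net G' leaf' → Lev2 G → Lev2 G' → One2 G →
    (∀ x y, G.dist (leaf x) (leaf y) = G'.dist (leaf' x) (leaf' y)) →
    ∃ φ : G ≃g G', ∀ x, φ (leaf x) = leaf' x := by
  intro n
  induction n with
  | zero =>
    intro V V' Y _ _ _ G G' leaf leaf' hn h h' hl hl' ho hd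
    have : IsEmpty Y := Fintype.card_eq_zero_iff.1 hn
    exact nocherry h h' hl hl' ho hd (fun x => isEmptyElim x)
  | succ n ih =>
    intro V V' Y _ _ _ G G' leaf leaf' hn h h' hl hl' ho hd
    by_cases hc : ∀ x y, G.dist (leaf x) (leaf y) ≠ 2
    · exact nocherry h h' hl hl' ho hd hc
    push Not at hc
    obtain ⟨x, y, hxy⟩ := hc
    obtain ⟨B, hB⟩ := ho.1
    have hna := h.nonadj hB
    have hna' : ∀ x y, ¬ G'.Adj (leaf' x) (leaf' y) := by
      intro x y hxy
      rw [← dist_eq_one_iff_adj, ← hd, dist_eq_one_iff_adj] at hxy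
      exact hna x y hxy
    have hne : x ≠ y := by
      rintro rfl
      simp at hxy
    obtain ⟨q, hqx, hqy⟩ := dist_two h.conn hxy
    obtain ⟨q', hqx', hqy'⟩ := dist_two h'.conn ((hd x y).symm.trans hxy)
    obtain ⟨V1, _, ι, leaf1, hi, hr, hl1, net1, lev1, one1, dist1⟩ := reduce h hna hne hqx hqy
    obtain ⟨V1', _, ι', leaf1', hi', hr', hl1', net1', lev1', -, dist1'⟩ :=
      reduce h' hna' hne hqx' hqy'
    have dq : ∀ w, w ≠ y → G.dist q (leaf w) = G'.dist q' (leaf' w) := by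
      intro w hw
      have e := dist_leaf h.conn hqy.symm (fun v hv => h.uniq y hv hqy.symm) (v := leaf w)
        (fun e => hw (h.inj e))
      have e' := dist_leaf h'.conn hqy'.symm (fun v hv => h'.uniq y hv hqy'.symm) (v := leaf' w)
        (fun e => hw (h'.inj e))
      have := hd y w
      omega
    obtain ⟨φ, hφ⟩ := ih (Y := {z : Y // z ≠ x}) (leaf := leaf1) (leaf' := leaf1')
      (by rw [Fintype.card_subtype_compl, hn]; simp)
      net1 net1' (lev1 hl) (lev1' hl') (one1 ho) (by
        intro z w
        rw [dist1, dist1', hl1, hl1, hl1', hl1']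
        split_ifs with h1 h2 h2
        · simp
        · exact dq _ h2
        · rw [dist_comm, dq _ h1, dist_comm]
        · exact hd _ _)
    have hφq : ∀ a, ι a = q ↔ ι' (φ a) = q' := by
      intro a
      have e1 := hl1 ⟨y, hne.symm⟩
      have e2 := hl1' ⟨y, hne.symm⟩
      rw [if_pos rfl] at e1 e2
      rw [← e1, ← e2, hi.eq_iff, hi'.eq_iff, ← hφ, φ.injective.eq_iff]
    let F : V1 ⊕ Bool → V := Sum.elim ι (fun b => if b then leaf x else leaf y)
    let F' : V1 ⊕ Bool → V' := Sum.elim (fun a => ι' (φ a)) (fun b => if b then leaf' x else leaf' y)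
    have lx : leaf x ≠ leaf y := fun e => hne (h.inj e)
    have lx' : leaf' x ≠ leaf' y := fun e => hne (h'.inj e)
    have bF : Function.Bijective F := by
      constructor
      · refine hi.sumElim ?_ ?_
        · rintro (_ | _) (_ | _) hab
          · rfl
          · exact absurd hab.symm lx
          · exact absurd hab lx
          · rfl
        · rintro a (_ | _)
          · exact ((hr _).1 ⟨a, rfl⟩).2
          · exact ((hr _).1 ⟨a, rfl⟩).1
      · intro v
        by_cases h1 : v = leaf x
        · exact ⟨Sum.inr true, h1.symm⟩
        by_cases h2 : v = leaf y
        · exact ⟨Sum.inr false, h2.symm⟩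
        obtain ⟨a, ha⟩ := (hr v).2 ⟨h1, h2⟩
        exact ⟨Sum.inl a, ha⟩
    have bF' : Function.Bijective F' := by
      constructor
      · refine (hi'.comp φ.injective).sumElim ?_ ?_
        · rintro (_ | _) (_ | _) hab
          · rfl
          · exact absurd hab.symm lx'
          · exact absurd hab lx'
          · rfl
        · rintro a (_ | _)
          · exact ((hr' _).1 ⟨φ a, rfl⟩).2
          · exact ((hr' _).1 ⟨φ a, rfl⟩).1
      · intro v
        by_cases h1 : v = leaf' x
        · exact ⟨Sum.inr true, h1.symm⟩
        by_cases h2 : v = leaf' y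
        · exact ⟨Sum.inr false, h2.symm⟩
        obtain ⟨a, ha⟩ := (hr' v).2 ⟨h1, h2⟩
        obtain ⟨a, rfl⟩ := φ.surjective a
        exact ⟨Sum.inl a, ha⟩
    have aux : ∀ a b, G.Adj (ι a) (if b = true then leaf x else leaf y) ↔
        G'.Adj (ι' (φ a)) (if b = true then leaf' x else leaf' y) := by
      have i1 : ∀ v b, G.Adj v (if b = true then leaf x else leaf y) ↔ v = q := by
        rintro v (_ | _)
        · exact ⟨fun hv => h.uniq y hv.symm hqy.symm, fun hv => hv ▸ hqy⟩
        · exact ⟨fun hv => h.uniq x hv.symm hqx.symm, fun hv => hv ▸ hqx⟩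
      have i2 : ∀ v b, G'.Adj v (if b = true then leaf' x else leaf' y) ↔ v = q' := by
        rintro v (_ | _)
        · exact ⟨fun hv => h'.uniq y hv.symm hqy'.symm, fun hv => hv ▸ hqy'⟩
        · exact ⟨fun hv => h'.uniq x hv.symm hqx'.symm, fun hv => hv ▸ hqx'⟩
      intro a b
      rw [i1, i2, hφq]
    obtain ⟨ψ, hψ⟩ := iso_param (G := G) (G' := G') F F' bF bF' (by
      rintro (a | a) (b | b)
      · exact (φ.map_adj_iff (v := a) (w := b)).symm
      · exact aux a b
      · rw [G.adj_comm, G'.adj_comm]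
        exact aux b a
      · refine iff_of_false ?_ ?_
        · rcases a with _ | _ <;> rcases b with _ | _ <;> exact hna _ _
        · rcases a with _ | _ <;> rcases b with _ | _ <;> exact hna' _ _)
    refine ⟨ψ, fun z => ?_⟩
    by_cases hzx : z = x
    · subst hzx
      exact hψ (Sum.inr true)
    by_cases hzy : z = y
    · subst hzy
      exact hψ (Sum.inr false)
    have e1 := hl1 ⟨z, hzx⟩
    have e2 := hl1' ⟨z, hzx⟩
    rw [if_neg hzy] at e1 e2
    have := hψ (Sum.inl (leaf1 ⟨z, hzx⟩))
    change ψ (ι (leaf1 ⟨z, hzx⟩)) = ι' (φ (leaf1 ⟨z, hzx⟩)) at this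
    rw [hφ, e1, e2] at this
    exact this

theorem sub_cut {V : Type} [Fintype V] {G : SimpleGraph V} (H : G.Subgraph)
    (hc : H.coe.Connected) {T U : Finset V} (hT : T.Nonempty) (hU : U.Nonempty)
    (hd : Disjoint T U) (hTU : ∀ v, v ∈ T ∨ v ∈ U ↔ v ∈ H.verts) :
    ∃ u ∈ T, ∃ v ∈ U, H.Adj u v := by
  by_contra hno
  push Not at hno
  obtain ⟨t, ht⟩ := hT
  obtain ⟨u, hu⟩ := hU
  have := closed_univ hc {v | v.1 ∈ T} ⟨⟨t, (hTU t).1 (Or.inl ht)⟩, ht⟩ (by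
    intro a b ha hab
    rcases (hTU b.1).2 b.2 with hb | hb
    · exact hb
    · exact absurd hab (hno _ ha _ hb)) ⟨u, (hTU u).1 (Or.inr hu)⟩
  exact Finset.disjoint_left.1 hd this hu

theorem cut_sub {V : Type} [Fintype V] {G : SimpleGraph V} (H : G.Subgraph)
    (hn : H.verts.Nonempty)
    (h : ∀ T U : Finset V, T.Nonempty → U.Nonempty → Disjoint T U →
      (∀ v, v ∈ T ∨ v ∈ U ↔ v ∈ H.verts) → ∃ u ∈ T, ∃ v ∈ U, H.Adj u v) :
    H.coe.Connected := by
  have : Nonempty H.verts := hn.to_subtype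
  refine ⟨fun a b => ?_⟩
  by_contra hab
  let P : V → Prop := fun v => ∃ hv : v ∈ H.verts, H.coe.Reachable a ⟨v, hv⟩
  obtain ⟨u, hu, v, hv, huv⟩ := h (Finset.univ.filter P)
    (Finset.univ.filter (fun v => v ∈ H.verts ∧ ¬ P v))
    ⟨a.1, by simp only [Finset.mem_filter, Finset.mem_univ, true_and]
             exact ⟨a.2, SimpleGraph.Reachable.refl _⟩⟩
    ⟨b.1, by simp only [Finset.mem_filter, Finset.mem_univ, true_and]
             exact ⟨b.2, fun ⟨_, h2⟩ => hab h2⟩⟩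
    (by
      rw [Finset.disjoint_left]
      intro w hw hw'
      simp only [Finset.mem_filter, Finset.mem_univ, true_and] at hw hw'
      exact hw'.2 hw)
    (by
      intro w
      simp only [Finset.mem_filter, Finset.mem_univ, true_and]
      constructor
      · rintro (⟨h1, -⟩ | h1)
        · exact h1
        · exact h1.1
      · intro hw
        by_cases hP : P w
        · exact Or.inl hP
        · exact Or.inr ⟨hw, hP⟩)
  simp only [Finset.mem_filter, Finset.mem_univ, true_and] at hu hv
  obtain ⟨hu1, hu2⟩ := hu
  refine hv.2 ⟨hv.1, hu2.trans (SimpleGraph.Adj.reachable ?_)⟩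
  exact huv

theorem tc_half {V : Type} [Fintype V] {G : SimpleGraph V} (H : G.Subgraph)
    (hc : H.coe.Connected) (hdel : ∀ v ∈ H.verts, (H.deleteVerts {v}).coe.Connected)
    {T U : Finset V} (hT : 2 ≤ T.card) (hU : U.Nonempty)
    (hd : Disjoint T U) (hTU : ∀ v, v ∈ T ∨ v ∈ U ↔ v ∈ H.verts) : 2 ≤ ee G T U := by
  by_contra hlt
  obtain ⟨u, hu, v, hv, huv⟩ := sub_cut H hc (Finset.card_pos.1 (by omega)) hU hd hTU
  obtain ⟨a, ha, b, hb, hab⟩ := sub_cut _ (hdel u (H.edge_vert huv)) (T := T.erase u)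
    (Finset.card_pos.1 (by rw [Finset.card_erase_of_mem hu]; omega)) hU
    (hd.mono_left (Finset.erase_subset _ _)) (by
      intro w
      rw [SimpleGraph.Subgraph.deleteVerts_verts, Set.mem_sdiff, ← hTU, Finset.mem_erase,
        Set.mem_singleton_iff]
      have : w ∈ U → w ≠ u := by
        rintro hw rfl
        exact Finset.disjoint_left.1 hd hu hw
      tauto)
  rw [SimpleGraph.Subgraph.deleteVerts_adj] at hab
  have := ee_unique G (by omega : ee G T U ≤ 1) hu hv (Finset.mem_of_mem_erase ha) hb huv.adj_sub
    hab.2.2.2.2.adj_sub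
  exact (Finset.mem_erase.1 ha).1 this.1.symm

theorem tc_E2 (N : LabGraph X) (H : N.G.Subgraph) (h : N.TwoConnSub H) :
    E2 N.G H.verts.toFinset := by
  obtain ⟨h3, hc, hdel⟩ := h
  rw [Set.ncard_eq_toFinset_card'] at h3
  refine ⟨h3, fun T U hT hU hd hTU => ?_⟩
  have hm : ∀ v, v ∈ T ∨ v ∈ U ↔ v ∈ H.verts := by
    intro v
    rw [← Finset.mem_union, hTU, Set.mem_toFinset]
  have hcard := Finset.card_union_of_disjoint hd
  rw [hTU] at hcard
  by_cases h2 : 2 ≤ T.card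
  · exact tc_half H hc hdel h2 hU hd hm
  · rw [ee_comm]
    exact tc_half H hc hdel (by omega) hT hd.symm (fun v => by rw [or_comm, hm])

theorem E2_tc (N : LabGraph X) (hdeg : ∀ v, ee N.G {v} Finset.univ ≤ 3) {B : Finset N.V}
    (h : E2 N.G B) : N.TwoConnSub ((⊤ : N.G.Subgraph).induce B) := by
  refine ⟨?_, ?_, ?_⟩
  · rw [SimpleGraph.Subgraph.induce_verts, Set.ncard_coe_finset]
    exact h.1
  · refine cut_sub _ ?_ ?_
    · rw [SimpleGraph.Subgraph.induce_verts]
      exact Finset.coe_nonempty.2 (Finset.card_pos.1 (by have := h.1; omega))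
    · intro T U hT hU hd hTU
      simp only [SimpleGraph.Subgraph.induce_verts, Finset.mem_coe] at hTU
      have := h.2 T U hT hU hd (by ext v; rw [Finset.mem_union, hTU])
      obtain ⟨u, hu, v, hv, huv⟩ := (ee_pos N.G).1 (by omega : 0 < ee N.G T U)
      refine ⟨u, hu, v, hv, ?_⟩
      rw [SimpleGraph.Subgraph.induce_adj]
      exact ⟨(hTU u).1 (Or.inl hu), (hTU v).1 (Or.inr hv), huv⟩
  · intro v hv
    rw [SimpleGraph.Subgraph.induce_verts, Finset.mem_coe] at hv
    refine cut_sub _ ?_ ?_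
    · rw [SimpleGraph.Subgraph.deleteVerts_verts, SimpleGraph.Subgraph.induce_verts]
      obtain ⟨w, hw⟩ := Finset.card_pos.1
        (by rw [Finset.card_erase_of_mem hv]; have := h.1; omega : 0 < (B.erase v).card)
      rw [Finset.mem_erase] at hw
      exact ⟨w, hw.2, hw.1⟩
    · intro T U hT hU hd hTU
      simp only [SimpleGraph.Subgraph.deleteVerts_verts, SimpleGraph.Subgraph.induce_verts,
        Set.mem_sdiff, Finset.mem_coe, Set.mem_singleton_iff] at hTU
      have hvT : v ∉ T := fun hh => ((hTU v).1 (Or.inl hh)).2 rfl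
      have hvU : v ∉ U := fun hh => ((hTU v).1 (Or.inr hh)).2 rfl
      by_contra hno
      have h0 : ee N.G T U = 0 := by
        rw [ee_eq_zero]
        intro a ha b hb hab
        refine hno ⟨a, ha, b, hb, ?_⟩
        have ha' := (hTU a).1 (Or.inl ha)
        have hb' := (hTU b).1 (Or.inr hb)
        rw [SimpleGraph.Subgraph.deleteVerts_adj]
        exact ⟨ha'.1, ha'.2, hb'.1, hb'.2, ha'.1, hb'.1, hab⟩
      have dT : Disjoint {v} T := by simpa using hvT
      have dU : Disjoint {v} U := by simpa using hvU
      have c1 := h.2 ({v} ∪ T) U (by simp) hU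
        (Finset.disjoint_union_left.2 ⟨dU, hd⟩) (by
          ext w
          have := hTU w
          simp only [Finset.mem_union, Finset.mem_singleton]
          by_cases hw : w = v
          · subst hw; tauto
          · tauto)
      have c2 := h.2 ({v} ∪ U) T (by simp) hT
        (Finset.disjoint_union_left.2 ⟨dT, hd.symm⟩) (by
          ext w
          have := hTU w
          simp only [Finset.mem_union, Finset.mem_singleton]
          by_cases hw : w = v
          · subst hw; tauto
          · tauto)
      rw [ee_union_left _ _ dT] at c1
      rw [ee_union_left _ _ dU, ee_comm _ U T] at c2
      have c3 := ee_union_right N.G {v} hd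
      have c4 := ee_mono N.G (subset_refl {v}) (Finset.subset_univ (T ∪ U))
      have := hdeg v
      omega

theorem exists_blob (N : LabGraph X) (hdeg : ∀ v, ee N.G {v} Finset.univ ≤ 3) {B : Finset N.V}
    (h : E2 N.G B) : ∃ W : Finset N.V, B ⊆ W ∧ E2 N.G W ∧
      N.IsBlob ((⊤ : N.G.Subgraph).induce W) := by
  obtain ⟨W, hBW, hW⟩ := (Set.toFinite {W : Finset N.V | E2 N.G W}).exists_le_maximal h
  refine ⟨W, hBW, hW.1, E2_tc N hdeg hW.1, ?_⟩
  intro H' hH' hle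
  have hv : W ⊆ H'.verts.toFinset := by
    intro v hv
    rw [Set.mem_toFinset]
    exact hle.1 hv
  have hs := hW.2 (tc_E2 N H' hH') hv
  refine le_antisymm (?_ : H' ≤ (⊤ : N.G.Subgraph).induce W) hle
  constructor
  · intro v hv
    exact hs (Set.mem_toFinset.2 hv)
  · intro u v huv
    rw [SimpleGraph.Subgraph.induce_adj]
    exact ⟨hs (Set.mem_toFinset.2 (H'.edge_vert huv)),
      hs (Set.mem_toFinset.2 (H'.edge_vert huv.symm)), huv.adj_sub⟩

theorem ee_edges {V : Type} [Fintype V] (G : SimpleGraph V) (W : Finset V) :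
    ee G W W ≤ 2 * ((⊤ : G.Subgraph).induce W).edgeSet.ncard := by
  rw [ee_eq_card]
  refine (Finset.card_le_mul_card_image (f := fun q : V × V => s(q.1, q.2)) _ 2 ?_).trans ?_
  · rintro e he
    obtain ⟨⟨u, v⟩, -, rfl⟩ := Finset.mem_image.1 he
    refine (Finset.card_le_card (t := {(u, v), (v, u)}) ?_).trans Finset.card_le_two
    rintro ⟨a, b⟩ hab
    have := (Finset.mem_filter.1 hab).2
    simp only [Sym2.eq_iff] at this
    simpa using this
  · refine Nat.mul_le_mul_left 2 ?_
    rw [Set.ncard_eq_toFinset_card']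
    refine Finset.card_le_card ?_
    intro e he
    obtain ⟨⟨u, v⟩, huv, rfl⟩ := Finset.mem_image.1 he
    rw [Finset.mem_filter, Finset.mem_product] at huv
    rw [Set.mem_toFinset, SimpleGraph.Subgraph.mem_edgeSet, SimpleGraph.Subgraph.induce_adj]
    exact ⟨huv.1.1, huv.1.2, huv.2⟩

theorem rank_mono {V : Type} {G : SimpleGraph V} {W : Finset V} (hW : E2 G W) :
    ∀ (n : ℕ) (B : Finset V), B ⊆ W → B.Nonempty → (W \ B).card = n →
      ee G B B + 2 * n ≤ ee G W W := by
  intro n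
  induction n with
  | zero =>
    intro B hB _ _
    exact ee_mono G hB hB
  | succ n ih =>
    intro B hB hn hc
    have := hW.2 B (W \ B) hn (Finset.card_pos.1 (by omega)) Finset.disjoint_sdiff
      (Finset.union_sdiff_of_subset hB)
    obtain ⟨b, hb, w, hw, hbw⟩ := (ee_pos G).1 (by omega : 0 < ee G B (W \ B))
    rw [Finset.mem_sdiff] at hw
    have hd : Disjoint {w} B := by simpa using hw.2
    have h1 := ih ({w} ∪ B) (Finset.union_subset (by simpa using hw.1) hB)
      (hn.mono Finset.subset_union_right) (by
        have : W \ ({w} ∪ B) = (W \ B).erase w := by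
          ext v
          simp only [Finset.mem_sdiff, Finset.mem_union, Finset.mem_singleton, Finset.mem_erase]
          tauto
        rw [this, Finset.card_erase_of_mem (by simpa using hw), hc]
        rfl)
    rw [ee_union_left G _ hd, ee_union_right G _ hd, ee_union_right G _ hd, ee_self,
      ee_comm G B {w}] at h1
    have h2 : 0 < ee G {w} B := (ee_pos G).2 ⟨w, by simp, b, hb, hbw.symm⟩
    omega

theorem level_Lev2 (N : LabGraph X) (hdeg : ∀ v, ee N.G {v} Finset.univ ≤ 3)
    (hl : N.IsLevel 2) : Lev2 N.G := by
  intro B hB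
  obtain ⟨W, hBW, hW, hblob⟩ := exists_blob N hdeg hB
  have h1 := hl _ hblob
  rw [SimpleGraph.Subgraph.induce_verts, Set.ncard_coe_finset] at h1
  have h2 := ee_edges N.G W
  have h3 := rank_mono hW _ B hBW (Finset.card_pos.1 (by have := hB.1; omega)) rfl
  have h4 := Finset.card_sdiff_add_card_eq_card hBW
  omega

theorem blob_One2 (N : LabGraph X) (hdeg : ∀ v, ee N.G {v} Finset.univ ≤ 3)
    (ho : ∃! H : N.G.Subgraph, N.IsBlob H) : One2 N.G := by
  obtain ⟨H, hH, hu⟩ := ho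
  refine ⟨⟨_, tc_E2 N H hH.1⟩, ?_⟩
  intro B1 B2 h1 h2
  obtain ⟨W1, s1, e1, b1⟩ := exists_blob N hdeg h1
  obtain ⟨W2, s2, e2, b2⟩ := exists_blob N hdeg h2
  have e := congrArg SimpleGraph.Subgraph.verts ((hu _ b1).trans (hu _ b2).symm)
  rw [SimpleGraph.Subgraph.induce_verts, SimpleGraph.Subgraph.induce_verts,
    Finset.coe_inj] at e
  subst e
  exact ⟨W1, e1, s1, s2⟩

theorem degOf_eq (N : LabGraph X) (v : N.V) : N.degOf v = ee N.G {v} Finset.univ := by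
  unfold degOf ee
  rw [Finset.sum_singleton, ← Finset.card_filter, Set.ncard_eq_toFinset_card']
  congr 1
  ext w
  simp

theorem Net.deg {V Y : Type} [Fintype V] {G : SimpleGraph V} {leaf : Y → V} (h : Net G leaf)
    (v : V) : ee G {v} Finset.univ ≤ 3 := by
  by_cases hv : v ∈ Set.range leaf
  · obtain ⟨x, rfl⟩ := hv
    rw [h.d1]
    omega
  · rw [h.d3 v hv]

theorem single_false {V Y : Type} [Fintype V] [Fintype Y] {G : SimpleGraph V} {leaf : Y → V}
    (h : Net G leaf) (hl : Lev2 G) (ho : One2 G) (hY : Fintype.card Y = 1) : False := by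
  obtain ⟨B, hB⟩ := ho.1
  have hna := h.nonadj hB
  choose p hp using h.parent
  have : Subsingleton Y := Fintype.card_le_one_iff_subsingleton.1 hY.le
  have inj : Function.Injective p := Function.injective_of_subsingleton p
  have cf := h.cf hna p hp inj
  have e2 := cf.bridgeless ho (by
    intro B hB v hv
    have := h.notleaf hB hv
    simpa using this)
  have h0 := cf.rest e2 hl
  have h1 := cf.degL
  have h2 := cf.degR
  have hu := Finset.union_sdiff_of_subset cf.image_sub
  have hd : Disjoint (Finset.univ.image p)
    ((Finset.univ \ Finset.univ.image leaf) \ Finset.univ.image p) := Finset.disjoint_sdiff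
  have h3 := ee_union_left G (Finset.univ \ Finset.univ.image leaf) hd
  have h5 := Finset.card_union_of_disjoint hd
  rw [hu] at h3 h5
  have h6 : (Finset.univ.image p).card = 1 := by
    rw [Finset.card_image_of_injective _ inj, Finset.card_univ, hY]
  have h7 := ee_three G (Finset.univ \ Finset.univ.image leaf)
  have h8 := e2.1
  omega

theorem isNetwork_net (N : LabGraph X) (hN : N.IsNetwork)
    (hn : ¬ (Fintype.card X = 1 ∧ Fintype.card N.V = 1)) : Net N.G N.leaf := by
  obtain ⟨hc, hi, h⟩ := hN
  rcases h with h | h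
  · exact absurd h hn
  · refine ⟨hc, hi, fun x => ?_, fun v hv => ?_⟩
    · rw [← degOf_eq]; exact h.1 x
    · rw [← degOf_eq]; exact h.2 v hv

theorem final_aux (N N' : LabGraph X) (hN : N.IsNetwork) (hN' : N'.IsNetwork)
    (hlev : N.IsLevel 2) (hlev' : N'.IsLevel 2)
    (hone : ∃! H : N.G.Subgraph, N.IsBlob H)
    (hd : ∀ x y : X, N.dm x y = N'.dm x y) :
    N.IsomLabelled N' := by
  have net : Net N.G N.leaf := isNetwork_net N hN (by
    rintro ⟨-, hV⟩
    obtain ⟨H, hH, -⟩ := hone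
    have h1 := hH.1.1
    rw [Set.ncard_eq_toFinset_card'] at h1
    have h2 := Finset.card_le_univ H.verts.toFinset
    omega)
  have lev := level_Lev2 N net.deg hlev
  have one := blob_One2 N net.deg hone
  have net' : Net N'.G N'.leaf := isNetwork_net N' hN' (by
    rintro ⟨hX, -⟩
    exact single_false net lev one hX)
  exact main_net _ rfl net net' lev (level_Lev2 N' net'.deg hlev') one hd

end Core

/-- Lemma: Level-2 networks containing exactly one blob are reconstructible from
their shortest distances. -/
theorem level2_single_blob_reconstructible_from_shortest_distances
    (X : Type) [Fintype X] [DecidableEq X]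
    (N N' : LabGraph X) (hN : N.IsNetwork) (hN' : N'.IsNetwork)
    (hlev : N.IsLevel 2) (hlev' : N'.IsLevel 2)
    (hone : ∃! H : N.G.Subgraph, N.IsBlob H)
    (hd : ∀ x y : X, N.dm x y = N'.dm x y) :
    N.IsomLabelled N' := by
  exact final_aux N N' hN hN' hlev hlev' hone hd

end LabGraph
end

section
/- Let N be a level-2 phylogenetic network on X with |X| ≥ 3. A leaf x of N is not contained in a blob if and only if there exists a unique partition X \ {x} = Y ∪ Z with Y ≠ ∅ and Z ≠ ∅ such that d_m(y,z) = d_m(x,y) + d_m(x,z) − 2 for all y ∈ Y and z ∈ Z. -/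
open SimpleGraph

namespace LabGraph

variable {X : Type} [Fintype X] [DecidableEq X]

/-- `Y ∪ Z` is a partition of `X \ {x}` into two non-empty parts such that
`d_m(y,z) = d_m(x,y) + d_m(x,z) - 2` for all `y ∈ Y` and `z ∈ Z`. -/
def GoodPartition (N : LabGraph X) (x : X) (Y Z : Set X) : Prop :=
  Y ∪ Z = {x}ᶜ ∧ Y ∩ Z = ∅ ∧ Y ≠ ∅ ∧ Z ≠ ∅ ∧
    ∀ y ∈ Y, ∀ z ∈ Z, N.dm y z + 2 = N.dm x y + N.dm x z


/-! ### Non-bridge edges -/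

section Helpers

set_option linter.unusedSectionVars false

variable {V : Type}

/-- The graph of non-bridge edges of `G`. -/
def NB (G : SimpleGraph V) : SimpleGraph V where
  Adj u w := G.Adj u w ∧ ¬ G.IsBridge s(u, w)
  symm := ⟨fun u w h => ⟨h.1.symm, by rw [Sym2.eq_swap]; exact h.2⟩⟩
  loopless := ⟨fun u h => G.loopless.irrefl u h.1⟩

/-- `a` and `b` are joined by a walk of non-bridge edges avoiding `w`. -/
def Rw (G : SimpleGraph V) (w a b : V) : Prop := ∃ p : (NB G).Walk a b, w ∉ p.support

theorem Rw.symm {G : SimpleGraph V} {w a b : V} (h : Rw G w a b) : Rw G w b a := by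
  obtain ⟨p, hp⟩ := h
  exact ⟨p.reverse, by simpa using hp⟩

theorem Rw.trans {G : SimpleGraph V} {w a b c : V} (h : Rw G w a b) (h' : Rw G w b c) :
    Rw G w a c := by
  obtain ⟨p, hp⟩ := h
  obtain ⟨q, hq⟩ := h'
  exact ⟨p.append q, by simp [Walk.mem_support_append_iff, hp, hq]⟩

theorem NB_adj_of_reachable {G : SimpleGraph V} {a b : V} (h : (NB G).Reachable a b)
    (hab : G.Adj a b) : (NB G).Adj a b := by
  refine ⟨hab, fun hb => hb ?_⟩
  refine h.mono ?_
  intro u w huw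
  rw [deleteEdges_adj]
  refine ⟨huw.1, ?_⟩
  intro he
  rw [Set.mem_singleton_iff] at he
  exact huw.2 (he ▸ hb)

theorem NB_second {G : SimpleGraph V} {w n : V} (h : (NB G).Adj w n) :
    ∃ n', n' ≠ n ∧ (NB G).Adj w n' ∧ Rw G w n' n := by
  classical
  obtain ⟨hadj, hb⟩ := h
  rw [isBridge_iff, not_not, reachable_deleteEdges_iff_exists_walk] at hb
  obtain ⟨p, hp⟩ := hb
  have hpp : p.bypass.IsPath := p.bypass_isPath
  have hpe : s(w, n) ∉ p.bypass.edges := fun h => hp (p.edges_bypass_subset_edges h)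
  generalize p.bypass = q at hpp hpe
  have hcyc : (Walk.cons hadj.symm q).IsCycle := by
    rw [Walk.cons_isCycle_iff]
    exact ⟨hpp, by rw [Sym2.eq_swap]; exact hpe⟩
  have hnb : ∀ e ∈ q.edges, ¬ G.IsBridge e := fun e he hbr =>
    hbr.notMem_edges_of_isCycle hcyc (by simp [he])
  cases q with
  | nil => exact absurd hadj (G.loopless.irrefl _)
  | @cons _ n' _ h1 r =>
    rw [Walk.cons_isPath_iff] at hpp
    refine ⟨n', ?_, ⟨h1, hnb _ (by simp)⟩, ?_⟩
    · rintro rfl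
      simp at hpe
    · have key : ∀ (a b : V) (r : G.Walk a b), (∀ e ∈ r.edges, ¬ G.IsBridge e) → w ∉ r.support →
          Rw G w a b := by
        intro a b r
        induction r with
        | nil => intro _ h; exact ⟨Walk.nil, h⟩
        | cons hh t ih =>
          intro h1 h2
          obtain ⟨t', ht'⟩ := ih (fun e he => h1 e (by simp [he])) (fun h => h2 (by simp [h]))
          have hnb' : (NB G).Adj _ _ := ⟨hh, h1 _ (by simp)⟩
          refine ⟨Walk.cons hnb' t', ?_⟩
          rw [Walk.support_cons, List.mem_cons, not_or] at h2 ⊢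
          exact ⟨h2.1, ht'⟩
      exact key _ _ r (fun e he => hnb e (by simp [he])) hpp.2

theorem NB_nbrs_conn {G : SimpleGraph V} {w n m : V} (h3 : (G.neighborSet w).ncard ≤ 3)
    (hfin : (G.neighborSet w).Finite)
    (hn : (NB G).Adj w n) (hm : (NB G).Adj w m) : Rw G w n m := by
  have rfl' : ∀ a, (NB G).Adj w a → Rw G w a a := fun a ha =>
    ⟨Walk.nil, by simpa using ha.ne⟩
  obtain ⟨n', hn1, hn2, hn3⟩ := NB_second hn
  obtain ⟨m', hm1, hm2, hm3⟩ := NB_second hm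
  by_cases e0 : n = m
  · subst e0; exact rfl' _ hn
  by_cases e1 : n' = m
  · subst e1; exact hn3.symm
  by_cases e2 : m' = n
  · subst e2; exact hm3
  by_cases e3 : n' = m'
  · subst e3; exact hn3.symm.trans hm3
  exfalso
  have hsub : ({n, m, n', m'} : Set V) ⊆ G.neighborSet w := by
    intro a ha
    rcases ha with rfl | rfl | rfl | rfl
    exacts [hn.1, hm.1, hn2.1, hm2.1]
  have := Set.ncard_le_ncard hsub hfin
  rw [Set.ncard_insert_of_notMem (by simp; grind) (by simp),
    Set.ncard_insert_of_notMem (by simp; grind) (by simp), Set.ncard_pair e3] at this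
  omega

theorem NB_start {G : SimpleGraph V} {w a : V} (p : (NB G).Walk w a) (hp : p.IsPath)
    (ha : a ≠ w) : ∃ n, (NB G).Adj w n ∧ Rw G w n a := by
  cases p with
  | nil => exact absurd rfl ha
  | cons h q =>
    rw [Walk.cons_isPath_iff] at hp
    exact ⟨_, h, q, hp.2⟩

theorem NB_avoid {G : SimpleGraph V} {w a b : V} (h3 : (G.neighborSet w).ncard ≤ 3)
    (hfin : (G.neighborSet w).Finite) (hab : (NB G).Reachable a b) (ha : a ≠ w) (hb : b ≠ w) :
    Rw G w a b := by
  classical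
  by_cases hw : (NB G).Reachable w a
  · obtain ⟨p, hp⟩ := hw.exists_isPath
    obtain ⟨q, hq⟩ := (hw.trans hab).exists_isPath
    obtain ⟨n, hn, hn'⟩ := NB_start p hp ha
    obtain ⟨m, hm, hm'⟩ := NB_start q hq hb
    exact hn'.symm.trans ((NB_nbrs_conn h3 hfin hn hm).trans hm')
  · obtain ⟨p⟩ := hab
    refine ⟨p, fun hm => hw ?_⟩
    exact ⟨(p.takeUntil w hm).reverse⟩

/-- Sides of a cut-edge `p q`: `S` is the side of `q`. -/
structure IsSide (G : SimpleGraph V) (S : Set V) (p q : V) : Prop where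
  memq : q ∈ S
  notp : p ∉ S
  adj : G.Adj p q
  exit : ∀ a b, a ∈ S → b ∉ S → G.Adj a b → a = q ∧ b = p

theorem IsSide.compl {G : SimpleGraph V} {S : Set V} {p q : V} (h : IsSide G S p q) :
    IsSide G Sᶜ q p where
  memq := h.notp
  notp := fun h' => h' h.memq
  adj := h.adj.symm
  exit a b ha hb hab := (h.exit b a (by simpa using hb) ha hab.symm).symm

theorem exists_side {G : SimpleGraph V} {p q : V} (hadj : G.Adj p q) (hb : G.IsBridge s(p, q)) :
    ∃ S, IsSide G S p q := by
  refine ⟨{w | (G.deleteEdges {s(p, q)}).Reachable q w}, Reachable.refl _, ?_, hadj, ?_⟩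
  · intro h
    exact hb (Reachable.symm h)
  · intro a b ha hb' hab
    by_cases he : s(a, b) = s(p, q)
    · rw [Sym2.eq_iff] at he
      rcases he with ⟨rfl, rfl⟩ | ⟨rfl, rfl⟩
      · exact absurd (Reachable.refl _) hb'
      · exact ⟨rfl, rfl⟩
    · exfalso
      apply hb'
      refine Reachable.trans ha (Adj.reachable ?_)
      rw [deleteEdges_adj]
      exact ⟨hab, he⟩

theorem IsSide.bridge {G : SimpleGraph V} {S : Set V} {p q : V} (h : IsSide G S p q) :
    G.IsBridge s(p, q) := by
  rw [isBridge_iff]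
  rintro ⟨r⟩
  obtain ⟨d, _, hd1, hd2⟩ := r.reverse.exists_boundary_dart S h.memq h.notp
  have := d.adj
  rw [deleteEdges_adj] at this
  obtain ⟨e1, e2⟩ := h.exit _ _ hd1 hd2 this.1
  apply this.2
  rw [e1, e2]
  exact Sym2.eq_swap

theorem IsSide.closed {G : SimpleGraph V} {S : Set V} {p q a b : V} (h : IsSide G S p q)
    (hab : (NB G).Reachable a b) (ha : a ∈ S) : b ∈ S := by
  by_contra hb
  obtain ⟨r⟩ := hab
  obtain ⟨d, _, hd1, hd2⟩ := r.exists_boundary_dart S ha hb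
  have := d.adj
  obtain ⟨e1, e2⟩ := h.exit _ _ hd1 hd2 this.1
  apply this.2
  rw [e1, e2, Sym2.eq_swap]
  exact h.bridge

theorem IsSide.dist {G : SimpleGraph V} (hG : G.Connected) {S : Set V} {p q w z : V}
    (h : IsSide G S p q) (hw : w ∈ S) (hz : z ∉ S) :
    G.dist w z = G.dist w q + 1 + G.dist p z := by
  have hpq : G.dist q p = 1 := dist_eq_one_iff_adj.mpr h.adj.symm
  have t1 := hG.dist_triangle (u := w) (v := q) (w := z)
  have t2 := hG.dist_triangle (u := q) (v := p) (w := z)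
  have key : ∀ (a b : V) (r : G.Walk a b), a ∈ S → b ∉ S →
      G.dist a q + 1 + G.dist p b ≤ r.length := by
    intro a b r
    induction r with
    | nil => intro h1 h2; exact absurd h1 h2
    | @cons a a' b hh t ih =>
      intro h1 h2
      rw [Walk.length_cons]
      by_cases h3 : a' ∈ S
      · have := ih h3 h2
        have h4 := hG.dist_triangle (u := a) (v := a') (w := q)
        have h5 : G.dist a a' = 1 := dist_eq_one_iff_adj.mpr hh
        omega
      · obtain ⟨rfl, rfl⟩ := h.exit _ _ h1 h3 hh
        have := dist_le t
        simp
        omega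
  obtain ⟨r, hr⟩ := hG.exists_walk_length_eq_dist w z
  have := key _ _ r hw hz
  omega

/-- `w` has three distinct non-bridge neighbours. -/
def Full (G : SimpleGraph V) (w : V) : Prop :=
  ∃ a b c, a ≠ b ∧ a ≠ c ∧ b ≠ c ∧ (NB G).Adj w a ∧ (NB G).Adj w b ∧ (NB G).Adj w c

theorem sub_nbr {G : SimpleGraph V} (H : G.Subgraph) (hc : H.coe.Connected) {w u : V}
    (hw : w ∈ H.verts) (hu : u ∈ H.verts) (hne : w ≠ u) : ∃ n, H.Adj w n := by
  obtain ⟨p⟩ := hc.preconnected ⟨w, hw⟩ ⟨u, hu⟩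
  cases p with
  | nil => exact absurd rfl hne
  | cons h _ => exact ⟨_, h⟩

theorem twoConn_nbrs (N : LabGraph X) {H : N.G.Subgraph} (hH : N.TwoConnSub H) {w : N.V}
    (hw : w ∈ H.verts) : ∃ n n', n ≠ n' ∧ H.Adj w n ∧ H.Adj w n' := by
  obtain ⟨h3, hc, hd⟩ := hH
  have ex : ∀ n, ∃ u ∈ H.verts, u ≠ w ∧ u ≠ n := by
    intro n
    by_contra! hcon
    have hsub : H.verts ⊆ {w, n} := by
      intro u hu
      by_cases h : u = w
      · simp [h]
      · simp [hcon u hu h]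
    have h1 := Set.ncard_le_ncard hsub (by simp)
    have h2 := Set.ncard_insert_le w {n}
    rw [Set.ncard_singleton] at h2
    omega
  obtain ⟨u, hu, huw, _⟩ := ex w
  obtain ⟨n, hn⟩ := sub_nbr H hc hw hu huw.symm
  obtain ⟨u', hu', huw', hun'⟩ := ex n
  obtain ⟨n', hn'⟩ := sub_nbr (H.deleteVerts {n}) (hd n hn.snd_mem) (w := w) (u := u')
    (by simpa using ⟨hw, hn.ne⟩) (by simpa using ⟨hu', hun'⟩) huw'.symm
  rw [Subgraph.deleteVerts_adj] at hn'
  refine ⟨n, n', ?_, hn, hn'.2.2.2.2⟩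
  rintro rfl
  simp at hn'

theorem blob_NB (N : LabGraph X) {H : N.G.Subgraph} (hH : N.TwoConnSub H) {w : N.V}
    (hw : w ∈ H.verts) : ∃ n, (NB N.G).Adj w n := by
  obtain ⟨n, n', hne, hn, hn'⟩ := twoConn_nbrs N hH hw
  refine ⟨n, hn.adj_sub, ?_⟩
  rw [isBridge_iff, not_not]
  have hc := hH.2.2 w hw
  have hr := hc.preconnected ⟨n', by simpa using ⟨hn'.snd_mem, hn'.ne.symm⟩⟩
    ⟨n, by simpa using ⟨hn.snd_mem, hn.ne.symm⟩⟩
  let f : (H.deleteVerts {w}).coe →g N.G.deleteEdges {s(w, n)} :=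
    { toFun := fun a => a.1
      map_rel' := by
        rintro ⟨a, ha⟩ ⟨b, hb⟩ hab
        rw [Subgraph.coe_adj, Subgraph.deleteVerts_adj] at hab
        rw [deleteEdges_adj]
        refine ⟨hab.2.2.2.2.adj_sub, ?_⟩
        intro he
        rw [Set.mem_singleton_iff, Sym2.eq_iff] at he
        rcases he with ⟨h, _⟩ | ⟨_, h⟩
        · exact hab.2.1 h
        · exact hab.2.2.2.1 h }
  have hr' := hr.map f
  refine Reachable.trans (Adj.reachable ?_) hr'
  change (N.G.deleteEdges {s(w, n)}).Adj w n'
  rw [deleteEdges_adj]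
  refine ⟨hn'.adj_sub, ?_⟩
  intro he
  rw [Set.mem_singleton_iff, Sym2.eq_iff] at he
  rcases he with ⟨_, h⟩ | ⟨h, h'⟩
  · exact hne h.symm
  · exact hn.ne h

theorem sub_reach {G : SimpleGraph V} (K : G.Subgraph)
    (hK : ∀ a b, a ∈ K.verts → b ∈ K.verts → (NB G).Adj a b → K.Adj a b) {a b : V}
    (p : (NB G).Walk a b) (hp : ∀ u ∈ p.support, u ∈ K.verts) :
    K.coe.Reachable ⟨a, hp a p.start_mem_support⟩ ⟨b, hp b p.end_mem_support⟩ := by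
  induction p with
  | nil => exact Reachable.refl _
  | @cons a c b h q ih =>
    have hq : ∀ u ∈ q.support, u ∈ K.verts := fun u hu => hp u (by simp [hu])
    refine Reachable.trans (Adj.reachable ?_) (ih hq)
    exact hK _ _ (hp a (by simp)) (hq c q.start_mem_support) h

/-- The non-bridge component of `v` as a subgraph. -/
def compSub (G : SimpleGraph V) (v : V) : G.Subgraph where
  verts := {w | (NB G).Reachable v w}
  Adj a b := (NB G).Adj a b ∧ (NB G).Reachable v a
  adj_sub h := h.1.1
  edge_vert h := h.2
  symm := ⟨fun _ _ h => ⟨h.1.symm, h.2.trans h.1.reachable⟩⟩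

theorem comp_twoConn (N : LabGraph X) (h3 : ∀ w, (N.G.neighborSet w).ncard ≤ 3) {v n : N.V}
    (hn : (NB N.G).Adj v n) : N.TwoConnSub (compSub N.G v) := by
  classical
  have hmem : ∀ w, w ∈ (compSub N.G v).verts ↔ (NB N.G).Reachable v w := fun w => Iff.rfl
  obtain ⟨n', hne, hn', _⟩ := NB_second hn
  refine ⟨?_, ?_, ?_⟩
  · have hsub : ({v, n, n'} : Set N.V) ⊆ (compSub N.G v).verts := by
      intro a ha
      rcases ha with rfl | rfl | rfl
      exacts [Reachable.refl _, hn.reachable, hn'.reachable]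
    have := Set.ncard_le_ncard hsub (Set.toFinite _)
    rw [Set.ncard_insert_of_notMem (by simp; exact ⟨hn.ne, hn'.ne⟩) (by simp),
      Set.ncard_pair hne.symm] at this
    exact this
  · rw [connected_iff]
    refine ⟨?_, ⟨⟨v, Reachable.refl _⟩⟩⟩
    rintro ⟨a, ha⟩ ⟨b, hb⟩
    have hab : (NB N.G).Reachable a b := (Reachable.symm ha).trans hb
    obtain ⟨p⟩ := hab
    exact sub_reach (compSub N.G v) (fun a b ha hb h => ⟨h, ha⟩) p
      (fun u hu => Reachable.trans ha ⟨p.takeUntil u hu⟩)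
  · intro w hw
    rw [connected_iff]
    have hv : ∀ a, a ∈ ((compSub N.G v).deleteVerts {w}).verts ↔
      (NB N.G).Reachable v a ∧ a ≠ w := fun a => by simp [hmem]
    refine ⟨?_, ?_⟩
    · rintro ⟨a, ha'⟩ ⟨b, hb'⟩
      have ha := (hv a).1 ha'
      have hb := (hv b).1 hb'
      have hab : (NB N.G).Reachable a b := (Reachable.symm ha.1).trans hb.1
      obtain ⟨p, hp⟩ := NB_avoid (h3 w) (Set.toFinite _) hab ha.2 hb.2
      have hs : ∀ u ∈ p.support, u ∈ ((compSub N.G v).deleteVerts {w}).verts := by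
        intro u hu
        rw [hv]
        exact ⟨ha.1.trans ⟨p.takeUntil u hu⟩, fun h => hp (h ▸ hu)⟩
      refine sub_reach ((compSub N.G v).deleteVerts {w}) ?_ p hs
      intro a b ha hb h
      rw [hv] at ha hb
      rw [Subgraph.deleteVerts_adj]
      exact ⟨ha.1, ha.2, hb.1, hb.2, h, ha.1⟩
    · by_cases h : v = w
      · exact ⟨⟨n, (hv n).2 ⟨hn.reachable, fun h' => hn.ne (h.trans h'.symm)⟩⟩⟩
      · exact ⟨⟨v, (hv v).2 ⟨Reachable.refl _, h⟩⟩⟩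

theorem exists_blob_s8 (N : LabGraph X) (h3 : ∀ w, (N.G.neighborSet w).ncard ≤ 3) {v n : N.V}
    (hn : (NB N.G).Adj v n) : ∃ H, N.IsBlob H ∧ compSub N.G v ≤ H := by
  obtain ⟨H, hle, hmax⟩ := Finite.exists_le_maximal (comp_twoConn N h3 hn)
  exact ⟨H, ⟨hmax.1, fun H' h1 h2 => le_antisymm (hmax.2 h1 h2) h2⟩, hle⟩

theorem no_three_full (N : LabGraph X) (h3 : ∀ w, (N.G.neighborSet w).ncard ≤ 3)
    (hlev : N.IsLevel 2) {a b c : N.V} (hab : a ≠ b) (hac : a ≠ c) (hbc : b ≠ c)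
    (fa : Full N.G a) (fb : Full N.G b) (fc : Full N.G c)
    (rab : (NB N.G).Reachable a b) (rac : (NB N.G).Reachable a c) : False := by
  classical
  obtain ⟨H, hH, hle⟩ : ∃ H, N.IsBlob H ∧ compSub N.G a ≤ H := by
    obtain ⟨n, _, _, _, _, _, hn, _⟩ := fa
    exact exists_blob_s8 N h3 hn
  have hl := hlev H hH
  have hs := H.spanningCoe.sum_degrees_eq_twice_card_edges
  have he : H.spanningCoe.edgeFinset.card = H.edgeSet.ncard := by
    rw [← Subgraph.edgeSet_spanningCoe, ← coe_edgeFinset, Set.ncard_coe_finset]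
  have hd2 : ∀ w ∈ H.verts, 2 ≤ H.spanningCoe.degree w := by
    intro w hw
    obtain ⟨n, n', hne, hn, hn'⟩ := twoConn_nbrs N hH.1 hw
    rw [← card_neighborFinset_eq_degree, ← Finset.card_pair hne]
    apply Finset.card_le_card
    intro u hu
    rw [mem_neighborFinset]
    simp only [Finset.mem_insert, Finset.mem_singleton] at hu
    rcases hu with rfl | rfl
    exacts [hn, hn']
  have hd3 : ∀ w, (NB N.G).Reachable a w → Full N.G w → 3 ≤ H.spanningCoe.degree w := by
    rintro w hw ⟨x, y, z, h1, h2, h3, h4, h5, h6⟩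
    have hc : Finset.card {x, y, z} = 3 := Finset.card_eq_three.2 ⟨x, y, z, h1, h2, h3, rfl⟩
    rw [← card_neighborFinset_eq_degree, ← hc]
    apply Finset.card_le_card
    intro u hu
    rw [mem_neighborFinset]
    simp only [Finset.mem_insert, Finset.mem_singleton] at hu
    rcases hu with rfl | rfl | rfl
    exacts [hle.2 ⟨h4, hw⟩, hle.2 ⟨h5, hw⟩, hle.2 ⟨h6, hw⟩]
  have hsum : ∑ w : N.V, ((if w ∈ H.verts then 2 else 0) +
      (if w ∈ ({a, b, c} : Finset N.V) then 1 else 0)) ≤ ∑ w, H.spanningCoe.degree w := by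
    apply Finset.sum_le_sum
    intro w _
    by_cases hw : w ∈ ({a, b, c} : Finset N.V)
    · have : 3 ≤ H.spanningCoe.degree w := by
        simp only [Finset.mem_insert, Finset.mem_singleton] at hw
        rcases hw with rfl | rfl | rfl
        exacts [hd3 _ (Reachable.refl _) fa, hd3 _ rab fb, hd3 _ rac fc]
      split_ifs <;> omega
    · by_cases hv : w ∈ H.verts
      · have := hd2 w hv
        rw [if_pos hv, if_neg hw]; exact this
      · simp [hw, hv]
  rw [Finset.sum_add_distrib, ← Finset.sum_filter, ← Finset.sum_filter, Finset.sum_const,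
    Finset.sum_const, Finset.filter_mem_eq_inter, Finset.univ_inter,
    Finset.card_eq_three.2 ⟨a, b, c, hab, hac, hbc, rfl⟩] at hsum
  have hv : (Finset.univ.filter (fun w => w ∈ H.verts)).card = H.verts.ncard := by
    rw [← Set.ncard_coe_finset]
    congr 1
    ext; simp
  rw [hv] at hsum
  simp only [smul_eq_mul] at hsum
  omega

/-- The combinatorial configuration around the vertex `v` of a blob. -/
structure Cfg (A : V → V → Prop) (v n1 n2 : V) (Y Z F : V → Prop) : Prop where
  symm : ∀ a b, A a b → A b a
  irr : ∀ a, ¬ A a a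
  hv : ∀ u, A v u → u = n1 ∨ u = n2
  nYF : ∀ u, Y u → ¬ F u
  nZF : ∀ u, Z u → ¬ F u
  nYZ : ∀ u, Y u → ¬ Z u
  nYv : ¬ Y v
  nZv : ¬ Z v
  nFv : ¬ F v
  cov : ∀ u w, F u → A u w → w = v ∨ Y w ∨ Z w ∨ F w
  hF : ∀ u, F u → ∃ a b c, a ≠ b ∧ a ≠ c ∧ b ≠ c ∧ A u a ∧ A u b ∧ A u c
  degY : ∀ u a b c, Y u → A u a → A u b → A u c → a = b ∨ a = c ∨ b = c
  degZ : ∀ u a b c, Z u → A u a → A u b → A u c → a = b ∨ a = c ∨ b = c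
  h3 : ∀ a b c, F a → F b → F c → A a b → (A a c ∨ A b c) → a = b ∨ a = c ∨ b = c
  ha : ∀ c c', Y c → Z c' → ¬ A c c'
  hb : ∀ c u c', Y c → Z c' → A c u → A u c' → A c v ∧ A c' v
  hc : ∀ c u w c', Y c → Z c' → A c u → A u w → A w c' →
    (A c v ∧ (A c' v ∨ ∃ m, A c' m ∧ A m v)) ∨ (A c' v ∧ (A c v ∨ ∃ m, A c m ∧ A m v))

theorem Cfg.swap {A : V → V → Prop} {v n1 n2 : V} {Y Z F : V → Prop}
    (h : Cfg A v n1 n2 Y Z F) : Cfg A v n1 n2 Z Y F where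
  symm := h.symm
  irr := h.irr
  hv := h.hv
  nYF := h.nZF
  nZF := h.nYF
  nYZ := fun u h1 h2 => h.nYZ u h2 h1
  nYv := h.nZv
  nZv := h.nYv
  nFv := h.nFv
  cov := fun u w h1 h2 => by rcases h.cov u w h1 h2 with h | h | h | h <;> simp [h]
  hF := h.hF
  degY := h.degZ
  degZ := h.degY
  h3 := h.h3
  ha := fun c c' h1 h2 h3 => h.ha c' c h2 h1 (h.symm _ _ h3)
  hb := fun c u c' h1 h2 h3 h4 => (h.hb c' u c h2 h1 (h.symm _ _ h4) (h.symm _ _ h3)).symm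
  hc := fun c u w c' h1 h2 h3 h4 h5 =>
    (h.hc c' w u c h2 h1 (h.symm _ _ h5) (h.symm _ _ h4) (h.symm _ _ h3)).symm

theorem Cfg.aux1 {A : V → V → Prop} {v n1 n2 : V} {Y Z F : V → Prop}
    (h : Cfg A v n1 n2 Y Z F) {c u c' t s : V} (hY : Y c) (hZ : Z c') (hu : F u)
    (hcu : A c u) (huc : A u c') (ht : F t) (hut : A u t) (hts : A t s) (hsu : s ≠ u)
    (hsv : s ≠ v) (hs : Y s) : False := by
  obtain ⟨h1, h2⟩ := h.hb c u c' hY hZ hcu huc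
  have hcc : ∀ m, A m v → m = c ∨ m = c' := by
    intro m hm
    have e1 := h.hv _ (h.symm _ _ hm)
    have e2 := h.hv _ (h.symm _ _ h1)
    have e3 := h.hv _ (h.symm _ _ h2)
    have e4 : c ≠ c' := fun e => h.nYZ c hY (e ▸ hZ)
    grind
  have huv : u ≠ v := fun e => h.nFv (e ▸ hu)
  have htv : t ≠ v := fun e => h.nFv (e ▸ ht)
  have hut' : u ≠ t := fun e => h.irr u (e ▸ hut)
  have hsc : s ≠ c := by
    rintro rfl
    have := h.degY s v u t hY h1 hcu (h.symm _ _ hts)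
    grind
  have hsc' : s ≠ c' := fun e => h.nYZ s hs (e ▸ hZ)
  rcases h.hc s t u c' hs hZ (h.symm _ _ hts) (h.symm _ _ hut) huc with ⟨h5, _⟩ | ⟨_, h5⟩
  · have := hcc s h5; grind
  · rcases h5 with h5 | ⟨m, h5, h6⟩
    · have := hcc s h5; grind
    · rcases hcc m h6 with rfl | rfl
      · have := h.degY m v u s hY h1 hcu (h.symm _ _ h5)
        grind
      · exact h.ha _ _ hs hZ h5

theorem third {A : V → V → Prop} {u : V}
    (h : ∃ a b c, a ≠ b ∧ a ≠ c ∧ b ≠ c ∧ A u a ∧ A u b ∧ A u c) (p q : V) :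
    ∃ t, t ≠ p ∧ t ≠ q ∧ A u t := by
  obtain ⟨a, b, c, h1, h2, h3, h4, h5, h6⟩ := h
  by_cases ha : a ≠ p ∧ a ≠ q
  · exact ⟨a, ha.1, ha.2, h4⟩
  by_cases hb : b ≠ p ∧ b ≠ q
  · exact ⟨b, hb.1, hb.2, h5⟩
  exact ⟨c, by grind, by grind, h6⟩

theorem Cfg.case1 {A : V → V → Prop} {v n1 n2 : V} {Y Z F : V → Prop}
    (h : Cfg A v n1 n2 Y Z F) {c u c' : V} (hY : Y c) (hZ : Z c') (hu : F u)
    (hcu : A c u) (huc : A u c') : False := by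
  obtain ⟨h1, h2⟩ := h.hb c u c' hY hZ hcu huc
  have hcc : ∀ m, A m v → m = c ∨ m = c' := by
    intro m hm
    have e1 := h.hv _ (h.symm _ _ hm)
    have e2 := h.hv _ (h.symm _ _ h1)
    have e3 := h.hv _ (h.symm _ _ h2)
    have e4 : c ≠ c' := fun e => h.nYZ c hY (e ▸ hZ)
    grind
  have hFcc : ∀ m, F m → ¬ A m v := by
    intro m hm hm'
    rcases hcc m hm' with rfl | rfl
    · exact h.nYF _ hY hm
    · exact h.nZF _ hZ hm
  obtain ⟨t, ht1, ht2, hut⟩ := third (h.hF u hu) c c'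
  have htv : t ≠ v := fun e => hFcc u hu (e ▸ hut)
  rcases h.cov u t hu hut with e | e | e | ht
  · exact htv e
  · have := hcc t (h.hb t u c' e hZ (h.symm _ _ hut) huc).1
    grind
  · have := hcc t (h.hb c u t hY e hcu hut).2
    grind
  · obtain ⟨s, hs1, _, hts⟩ := third (h.hF t ht) u u
    have hsv : s ≠ v := fun e => hFcc t ht (e ▸ hts)
    rcases h.cov t s ht hts with e | e | e | e
    · exact hsv e
    · exact h.aux1 hY hZ hu hcu huc ht hut hts hs1 hsv e
    · exact h.swap.aux1 hZ hY hu (h.symm _ _ huc) (h.symm _ _ hcu) ht hut hts hs1 hsv e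
    · rcases h.h3 u t s hu ht e hut (Or.inr hts) with e | e | e
      · exact h.irr u (e ▸ hut)
      · exact hs1 e.symm
      · exact h.irr t (e ▸ hts)

theorem Cfg.case2 {A : V → V → Prop} {v n1 n2 : V} {Y Z F : V → Prop}
    (h : Cfg A v n1 n2 Y Z F) {c u w c' : V} (hY : Y c) (hZ : Z c') (hu : F u) (hw : F w)
    (hcu : A c u) (huw : A u w) (hwc : A w c') : False := by
  have hne : u ≠ w := fun e => h.irr u (e ▸ huw)
  have hv3 : ∀ a b d, A a v → A b v → A d v → a = b ∨ a = d ∨ b = d := by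
    intro a b d h1 h2 h3
    have e1 := h.hv _ (h.symm _ _ h1)
    have e2 := h.hv _ (h.symm _ _ h2)
    have e3 := h.hv _ (h.symm _ _ h3)
    grind
  obtain ⟨t, ht1, ht2, hut⟩ := third (h.hF u hu) c w
  obtain ⟨t', ht1', ht2', hwt⟩ := third (h.hF w hw) c' u
  have tt : t = v ∨ Y t := by
    rcases h.cov u t hu hut with e | e | e | e
    · exact Or.inl e
    · exact Or.inr e
    · exact (h.case1 hY e hu hcu hut).elim
    · rcases h.h3 u w t hu hw e huw (Or.inl hut) with e | e | e
      · exact absurd e hne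
      · exact (h.irr u (e ▸ hut)).elim
      · exact absurd e.symm ht2
  have tt' : t' = v ∨ Z t' := by
    rcases h.cov w t' hw hwt with e | e | e | e
    · exact Or.inl e
    · exact (h.case1 e hZ hw (h.symm _ _ hwt) hwc).elim
    · exact Or.inr e
    · rcases h.h3 u w t' hu hw e huw (Or.inr hwt) with e | e | e
      · exact absurd e hne
      · exact absurd e.symm ht2'
      · exact (h.irr w (e ▸ hwt)).elim
  -- for all `Y`-neighbours of `u` and `Z`-neighbours of `w`, one of them is adjacent to `v`
  have key : ∀ d d', Y d → Z d' → A d u → A w d' → A d v ∨ A d' v := by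
    intro d d' h1 h2 h3 h4
    rcases h.hc d u w d' h1 h2 h3 huw h4 with h5 | h5
    · exact Or.inl h5.1
    · exact Or.inr h5.1
  have hcF : ∀ d e, Y d → F e → d ≠ e := fun d e h1 h2 h3 => h.nYF d h1 (h3 ▸ h2)
  have hcF' : ∀ d e, Z d → F e → d ≠ e := fun d e h1 h2 h3 => h.nZF d h1 (h3 ▸ h2)
  -- two `Y`-neighbours of `v` and another vertex `c'`
  have both : ∀ d e, Y d → Y e → d ≠ e → A d v → A e v → A d u → False := by
    intro d e h1 h2 h3 h4 h5 h6
    have hno : ¬ A c' v := by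
      intro h7
      have q1 := hv3 d e c' h4 h5 h7
      have q2 : d ≠ c' := fun e' => h.nYZ d h1 (e' ▸ hZ)
      have q3 : e ≠ c' := fun e' => h.nYZ e h2 (e' ▸ hZ)
      grind
    rcases h.hc d u w c' h1 hZ h6 huw hwc with ⟨_, h7 | ⟨m, h7, h8⟩⟩ | ⟨h7, _⟩
    · exact hno h7
    · rcases hv3 d e m h4 h5 h8 with q | q | q
      · exact h3 q
      · exact h.ha _ _ h1 hZ (h.symm _ _ (q ▸ h7))
      · exact h.ha _ _ h2 hZ (h.symm _ _ (q ▸ h7))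
    · exact hno h7
  have both' : ∀ d e, Z d → Z e → d ≠ e → A d v → A e v → A w d → False := by
    intro d e h1 h2 h3 h4 h5 h6
    have hno : ¬ A c v := by
      intro h7
      have q1 := hv3 d e c h4 h5 h7
      have q2 : d ≠ c := fun e' => h.nYZ c hY (e' ▸ h1)
      have q3 : e ≠ c := fun e' => h.nYZ c hY (e' ▸ h2)
      grind
    rcases h.hc c u w d hY h1 hcu huw h6 with ⟨h7, _⟩ | ⟨_, h7 | ⟨m, h7, h8⟩⟩
    · exact hno h7
    · exact hno h7
    · rcases hv3 d e m h4 h5 h8 with q | q | q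
      · exact h3 q
      · exact h.ha _ _ hY h1 (q ▸ h7)
      · exact h.ha _ _ hY h2 (q ▸ h7)
  have k1 := key c c' hY hZ hcu hwc
  have hYZ : ∀ d d', Y d → Z d' → d ≠ d' := fun d d' h1 h2 h3 => h.nYZ d h1 (h3 ▸ h2)
  rcases tt with rfl | tY <;> rcases tt' with rfl | tZ
  · have q1 := hcF _ _ hY hu
    have q2 := hcF _ _ hY hw
    have q3 := hcF' _ _ hZ hu
    have q4 := hcF' _ _ hZ hw
    rcases k1 with k | k
    · have := hv3 _ _ _ hut hwt k; grind
    · have := hv3 _ _ _ hut hwt k; grind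
  · -- `u` adjacent to `v`
    have k2 := key c t' hY tZ hcu hwt
    have q1 := hcF _ _ hY hu
    have q3 := hcF' _ _ hZ hu
    have q4 := hcF' _ _ tZ hu
    by_cases kc : A c t
    · -- `c, u` are the neighbours of `v`
      rcases h.hc c u w c' hY hZ hcu huw hwc with ⟨_, h7 | ⟨m, h7, h8⟩⟩ | ⟨h7, _⟩
      · have := hv3 _ _ _ hut kc h7; have := hYZ _ _ hY hZ; grind
      · rcases hv3 _ _ _ hut kc h8 with q | q | q
        · exact q1 q.symm
        · subst q
          exact h.case1 hY hZ hu hcu (h.symm _ _ h7)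
        · subst q
          exact h.ha _ _ hY hZ (h.symm _ _ h7)
      · have := hv3 _ _ _ hut kc h7; have := hYZ _ _ hY hZ; grind
    · have := hv3 _ _ _ hut (k1.resolve_left kc) (k2.resolve_left kc)
      grind
  · have k2 := key t c' tY hZ (h.symm _ _ hut) hwc
    have q1 := hcF' _ _ hZ hw
    have q3 := hcF _ _ hY hw
    have q4 := hcF _ _ tY hw
    by_cases kc : A c' t'
    · rcases h.hc c u w c' hY hZ hcu huw hwc with ⟨h7, _⟩ | ⟨_, h7 | ⟨m, h7, h8⟩⟩
      · have := hv3 _ _ _ hwt kc h7; have := hYZ _ _ hY hZ; grind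
      · have := hv3 _ _ _ hwt kc h7; have := hYZ _ _ hY hZ; grind
      · rcases hv3 _ _ _ hwt kc h8 with q | q | q
        · exact q1 q.symm
        · subst q
          exact h.case1 hY hZ hw h7 hwc
        · subst q
          exact h.ha _ _ hY hZ h7
    · have := hv3 _ _ _ hwt (k1.resolve_right kc) (k2.resolve_right kc)
      grind
  · have k2 := key c t' hY tZ hcu hwt
    have k3 := key t c' tY hZ (h.symm _ _ hut) hwc
    have k4 := key t t' tY tZ (h.symm _ _ hut) hwt
    by_cases kc : A c v
    · by_cases kt : A t v
      · exact both c t hY tY ht1.symm kc kt hcu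
      · exact both' c' t' hZ tZ ht1'.symm (k3.resolve_left kt) (k4.resolve_left kt) hwc
    · exact both' c' t' hZ tZ ht1'.symm (k1.resolve_left kc) (k2.resolve_left kc) hwc

/-- Degrees of a network, in usable form. -/
structure Net_s8 (N : LabGraph X) : Prop where
  conn : N.G.Connected
  inj : Function.Injective N.leaf
  hL : ∀ y, ∃ v, ∀ u, N.G.Adj (N.leaf y) u ↔ u = v
  hI : ∀ w, w ∉ Set.range N.leaf → ∃ a b c, a ≠ b ∧ a ≠ c ∧ b ≠ c ∧
    ∀ u, N.G.Adj w u ↔ u = a ∨ u = b ∨ u = c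
  h3 : ∀ w, (N.G.neighborSet w).ncard ≤ 3

theorem IsNetwork.net {N : LabGraph X} (hX : 3 ≤ Fintype.card X) (hN : N.IsNetwork) : Net_s8 N := by
  obtain ⟨h1, h2, h3 | ⟨h3, h4⟩⟩ := hN
  · omega
  refine ⟨h1, h2, ?_, ?_, ?_⟩
  · intro y
    obtain ⟨v, hv⟩ := Set.ncard_eq_one.1 (h3 y)
    refine ⟨v, fun u => ?_⟩
    rw [← mem_neighborSet, hv, Set.mem_singleton_iff]
  · intro w hw
    obtain ⟨a, b, c, hab, hac, hbc, h⟩ := Set.ncard_eq_three.1 (h4 w hw)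
    refine ⟨a, b, c, hab, hac, hbc, fun u => ?_⟩
    rw [← mem_neighborSet, h]
    simp
  · intro w
    by_cases hw : w ∈ Set.range N.leaf
    · obtain ⟨y, rfl⟩ := hw
      have := h3 y
      unfold degOf at this
      omega
    · exact (h4 w hw).le

theorem Net_s8.leaf_no_NB {N : LabGraph X} (hN : Net_s8 N) (y : X) (n : N.V) :
    ¬ (NB N.G).Adj (N.leaf y) n := by
  intro h
  obtain ⟨n', h1, h2, _⟩ := NB_second h
  obtain ⟨v, hv⟩ := hN.hL y
  exact h1 (((hv _).1 h2.1).trans ((hv _).1 h.1).symm)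

theorem Net_s8.side_leaf {N : LabGraph X} (hN : Net_s8 N) (hlev : N.IsLevel 2) :
    ∀ (k : ℕ) (S : Set N.V) (p q : N.V), S.ncard = k → IsSide N.G S p q →
      ∃ y, N.leaf y ∈ S := by
  intro k
  induction k using Nat.strong_induction_on with
  | _ k ih =>
  intro S p q hk hS
  by_contra! hno
  have hrange : ∀ w ∈ S, w ∉ Set.range N.leaf := by
    rintro w hw ⟨y, rfl⟩
    exact hno y hw
  have small : ∀ (T : Set N.V) (c d : N.V), IsSide N.G T c d → c ∈ S → d ∈ S → p ∉ T → False := by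
    intro T c d hT hc hd hp
    have hside : IsSide N.G (T ∩ S) c d := by
      refine ⟨⟨hT.memq, hd⟩, fun h => hT.notp h.1, hT.adj, ?_⟩
      intro a b ha hb hab
      by_cases hbT : b ∈ T
      · have hbS : b ∉ S := fun h => hb ⟨hbT, h⟩
        obtain ⟨_, rfl⟩ := hS.exit a b ha.2 hbS hab
        exact absurd hbT hp
      · exact hT.exit a b ha.1 hbT hab
    have hlt : (T ∩ S).ncard < S.ncard := by
      apply Set.ncard_lt_ncard _ (Set.toFinite _)
      refine ⟨Set.inter_subset_right, fun h => hT.notp (h hc).1⟩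
    obtain ⟨y, hy⟩ := ih _ (hk ▸ hlt) (T ∩ S) c d rfl hside
    exact hno y hy.2
  have hnb : ∀ c d, c ∈ S → d ∈ S → N.G.Adj c d → (NB N.G).Adj c d := by
    intro c d hc hd hcd
    refine ⟨hcd, fun hb => ?_⟩
    obtain ⟨T, hT⟩ := exists_side hcd hb
    by_cases hp : p ∈ T
    · exact small Tᶜ d c hT.compl hd hc (fun h => h hp)
    · exact small T c d hT hc hd hp
  have hin : ∀ c d, c ∈ S → c ≠ q → N.G.Adj c d → d ∈ S := by
    intro c d hc hcq hcd
    by_contra hd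
    exact hcq (hS.exit c d hc hd hcd).1
  have hfull : ∀ c, c ∈ S → c ≠ q → Full N.G c := by
    intro c hc hcq
    obtain ⟨a, b, e, h1, h2, h3, h4⟩ := hN.hI c (hrange c hc)
    have ha := (h4 a).2 (by simp)
    have hb := (h4 b).2 (by simp)
    have he := (h4 e).2 (by simp)
    exact ⟨a, b, e, h1, h2, h3, hnb _ _ hc (hin _ _ hc hcq ha) ha,
      hnb _ _ hc (hin _ _ hc hcq hb) hb, hnb _ _ hc (hin _ _ hc hcq he) he⟩
  have hqin : ∀ d, N.G.Adj q d → d ≠ p → d ∈ S := by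
    intro d hd hdp
    by_contra h
    exact hdp (hS.exit q d hS.memq h hd).2
  have nb3 : ∀ w ∈ S, ∃ a b c, a ≠ b ∧ a ≠ c ∧ b ≠ c ∧ N.G.Adj w a ∧ N.G.Adj w b ∧ N.G.Adj w c := by
    intro w hw
    obtain ⟨a, b, e, h1, h2, h3, h4⟩ := hN.hI w (hrange w hw)
    exact ⟨a, b, e, h1, h2, h3, (h4 a).2 (by simp), (h4 b).2 (by simp), (h4 e).2 (by simp)⟩
  obtain ⟨a1, ha1, _, hqa1⟩ := third (nb3 q hS.memq) p p
  obtain ⟨a2, ha2, ha12, hqa2⟩ := third (nb3 q hS.memq) p a1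
  have ha1S := hqin _ hqa1 ha1
  have ha2S := hqin _ hqa2 ha2
  obtain ⟨a3, ha3, ha32, h13⟩ := third (nb3 a1 ha1S) q a2
  have ha3S := hin _ _ ha1S hqa1.ne' h13
  have r13 : (NB N.G).Adj a1 a3 := hnb _ _ ha1S ha3S h13
  have r1 := hnb _ _ hS.memq ha1S hqa1
  have r2 := hnb _ _ hS.memq ha2S hqa2
  exact no_three_full N hN.h3 hlev ha12.symm h13.ne ha32.symm (hfull _ ha1S hqa1.ne')
    (hfull _ ha2S hqa2.ne') (hfull _ ha3S ha3) (r1.symm.reachable.trans r2.reachable)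
    r13.reachable

theorem Net_s8.leaf_side {N : LabGraph X} (hN : Net_s8 N) {x : X} {v : N.V}
    (hv : ∀ u, N.G.Adj (N.leaf x) u ↔ u = v) : IsSide N.G {N.leaf x} v (N.leaf x) where
  memq := rfl
  notp := ((hv v).2 rfl).ne'
  adj := ((hv v).2 rfl).symm
  exit a b ha hb hab := by
    obtain rfl : a = N.leaf x := ha
    exact ⟨rfl, (hv b).1 hab⟩

theorem Net_s8.univ_of_closed {N : LabGraph X} (hN : Net_s8 N) (T : Set N.V) {a : N.V} (ha : a ∈ T)
    (h : ∀ u w, u ∈ T → N.G.Adj u w → w ∈ T) (b : N.V) : b ∈ T := by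
  by_contra hb
  obtain ⟨p⟩ := hN.conn.preconnected a b
  obtain ⟨d, _, h1, h2⟩ := p.exists_boundary_dart T ha hb
  exact h2 (h _ _ h1 d.adj)

theorem Net_s8.nbr_notleaf {N : LabGraph X} (hN : Net_s8 N) (hX : 3 ≤ Fintype.card X) {x : X} {v : N.V}
    (hv : ∀ u, N.G.Adj (N.leaf x) u ↔ u = v) : v ∉ Set.range N.leaf := by
  rintro ⟨y, rfl⟩
  obtain ⟨v', hv'⟩ := hN.hL y
  have e : v' = N.leaf x := ((hv' _).1 ((hv _).2 rfl).symm).symm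
  subst e
  have hall := hN.univ_of_closed {N.leaf x, N.leaf y} (a := N.leaf x) (by simp) (by
    rintro u w (rfl | rfl) h
    · simp [(hv w).1 h]
    · simp [(hv' w).1 h])
  have hsub : (Finset.univ : Finset X) ⊆ {x, y} := by
    intro z _
    rcases hall (N.leaf z) with h | h
    · simp [hN.inj h]
    · simp [hN.inj h]
  have := Finset.card_le_card hsub
  have h2 := Finset.card_le_two (a := x) (b := y)
  rw [Finset.card_univ] at this
  omega

theorem Net_s8.forward {N : LabGraph X} (hN : Net_s8 N) (hlev : N.IsLevel 2)
    (hX : 3 ≤ Fintype.card X) {x : X} {v : N.V} (hv : ∀ u, N.G.Adj (N.leaf x) u ↔ u = v)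
    (hno : ∀ n, ¬ (NB N.G).Adj v n) :
    ∃ Y Z : Set X, GoodPartition N x Y Z ∧
        ∀ Y' Z' : Set X, GoodPartition N x Y' Z' →
          (Y' = Y ∧ Z' = Z) ∨ (Y' = Z ∧ Z' = Y) := by
  have hvr := hN.nbr_notleaf hX hv
  have hxv : N.G.Adj v (N.leaf x) := ((hv v).2 rfl).symm
  obtain ⟨a, b, hab, hax, hbx, hvn⟩ : ∃ a b, a ≠ b ∧ a ≠ N.leaf x ∧ b ≠ N.leaf x ∧
      ∀ u, N.G.Adj v u ↔ u = N.leaf x ∨ u = a ∨ u = b := by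
    obtain ⟨a, b, c, h1, h2, h3, h4⟩ := hN.hI v hvr
    rcases (h4 _).1 hxv with e | e | e
    · exact ⟨b, c, h3, by grind, by grind, by grind⟩
    · exact ⟨a, c, h2, by grind, by grind, by grind⟩
    · exact ⟨a, b, h1, by grind, by grind, by grind⟩
  have hbr : ∀ u, N.G.Adj v u → ∃ S, IsSide N.G S v u := by
    intro u hu
    refine exists_side hu ?_
    by_contra hb
    exact hno u ⟨hu, hb⟩
  have hva := (hvn a).2 (by simp)
  have hvb := (hvn b).2 (by simp)
  obtain ⟨A, hA⟩ := hbr a hva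
  obtain ⟨B, hB⟩ := hbr b hvb
  have hxA : N.leaf x ∉ A := fun h => hax (hA.exit _ _ h hA.notp hxv.symm).1.symm
  have hxB : N.leaf x ∉ B := fun h => hbx (hB.exit _ _ h hB.notp hxv.symm).1.symm
  have hbA : b ∉ A := fun h => hab (hA.exit _ _ h hA.notp hvb.symm).1.symm
  have haB : a ∉ B := fun h => hab (hB.exit _ _ h hB.notp hva.symm).1
  have hdisj : ∀ w, w ∈ A → w ∉ B := by
    intro w h1 h2
    have e1 := hA.dist hN.conn h1 hbA
    have e2 := hB.dist hN.conn h2 haB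
    omega
  have hall := hN.univ_of_closed {u | u = v ∨ u = N.leaf x ∨ u ∈ A ∨ u ∈ B} (a := v) (by simp) (by
    rintro u w (rfl | rfl | h | h) huw
    · rcases (hvn w).1 huw with rfl | rfl | rfl
      · simp
      · simp [hA.memq]
      · simp [hB.memq]
    · simp [(hv w).1 huw]
    · by_cases hw : w ∈ A
      · simp [hw]
      · simp [(hA.exit _ _ h hw huw).2]
    · by_cases hw : w ∈ B
      · simp [hw]
      · simp [(hB.exit _ _ h hw huw).2])
  have hxs := hN.leaf_side hv
  have hdx : ∀ y, y ≠ x → N.dm x y = 1 + N.G.dist v (N.leaf y) := by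
    intro y hy
    have := hxs.dist hN.conn (w := N.leaf x) (z := N.leaf y) rfl
      (fun h => hy (hN.inj h))
    rw [dist_self] at this
    unfold dm
    omega
  have hAv : ∀ y, y ∈ A → N.G.dist v y = N.G.dist y a + 1 := by
    intro y hy
    have := hA.dist hN.conn hy hA.notp
    rw [dist_self] at this
    rw [dist_comm]; omega
  have hBv : ∀ y, y ∈ B → N.G.dist v y = N.G.dist y b + 1 := by
    intro y hy
    have := hB.dist hN.conn hy hB.notp
    rw [dist_self] at this
    rw [dist_comm]; omega
  have hneA : ∀ y, N.leaf y ∈ A → y ≠ x := fun y h e => hxA (e ▸ h)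
  have hneB : ∀ y, N.leaf y ∈ B → y ≠ x := fun y h e => hxB (e ▸ h)
  obtain ⟨y0, hy0⟩ := hN.side_leaf hlev _ A v a rfl hA
  obtain ⟨z0, hz0⟩ := hN.side_leaf hlev _ B v b rfl hB
  have hcover : ∀ y, y ≠ x → N.leaf y ∈ A ∨ N.leaf y ∈ B := by
    intro y hy
    rcases hall (N.leaf y) with h | h | h
    · exact absurd ⟨y, h⟩ hvr
    · exact absurd (hN.inj h) hy
    · exact h
  refine ⟨{y | N.leaf y ∈ A}, {y | N.leaf y ∈ B}, ⟨?_, ?_, ?_, ?_, ?_⟩, ?_⟩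
  · ext y
    simp only [Set.mem_union, Set.mem_setOf_eq, Set.mem_compl_iff, Set.mem_singleton_iff]
    constructor
    · rintro (h | h)
      exacts [hneA y h, hneB y h]
    · exact hcover y
  · ext y
    simp only [Set.mem_inter_iff, Set.mem_setOf_eq, Set.mem_empty_iff_false, iff_false]
    exact fun h => hdisj _ h.1 h.2
  · exact Set.Nonempty.ne_empty ⟨y0, hy0⟩
  · exact Set.Nonempty.ne_empty ⟨z0, hz0⟩
  · intro y hy z hz
    have e1 := hdx y (hneA y hy)
    have e2 := hdx z (hneB z hz)
    have e3 := hA.dist hN.conn (w := N.leaf y) (z := N.leaf z) hy (fun h => hdisj _ h hz)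
    have e4 := hAv _ hy
    unfold dm at *
    omega
  · intro Y' Z' ⟨g1, g2, g3, g4, g5⟩
    have cov' : ∀ y, y ≠ x → y ∈ Y' ∨ y ∈ Z' := by
      intro y hy
      have : y ∈ Y' ∪ Z' := by rw [g1]; exact hy
      exact this
    have nx : ∀ y, y ∈ Y' ∨ y ∈ Z' → y ≠ x := by
      intro y hy
      have : y ∈ ({x}ᶜ : Set X) := by rw [← g1]; exact hy
      exact this
    have dj : ∀ y, y ∈ Y' → y ∉ Z' := by
      intro y h1 h2
      have : y ∈ Y' ∩ Z' := ⟨h1, h2⟩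
      rw [g2] at this
      exact this
    have sepA : ∀ y z, y ∈ Y' → z ∈ Z' → N.leaf y ∈ A → N.leaf z ∈ A → False := by
      intro y z hy hz h1 h2
      have e0 := g5 y hy z hz
      have e1 := hdx y (hneA y h1)
      have e2 := hdx z (hneA z h2)
      have e3 := hAv _ h1
      have e4 := hAv _ h2
      have t := hN.conn.dist_triangle (u := N.leaf y) (v := a) (w := N.leaf z)
      rw [dist_comm (u := a)] at t
      unfold dm at *
      omega
    have sepB : ∀ y z, y ∈ Y' → z ∈ Z' → N.leaf y ∈ B → N.leaf z ∈ B → False := by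
      intro y z hy hz h1 h2
      have e0 := g5 y hy z hz
      have e1 := hdx y (hneB y h1)
      have e2 := hdx z (hneB z h2)
      have e3 := hBv _ h1
      have e4 := hBv _ h2
      have t := hN.conn.dist_triangle (u := N.leaf y) (v := b) (w := N.leaf z)
      rw [dist_comm (u := b)] at t
      unfold dm at *
      omega
    obtain ⟨p, hp⟩ := Set.nonempty_iff_ne_empty.2 g3
    obtain ⟨q, hq⟩ := Set.nonempty_iff_ne_empty.2 g4
    have ext' : ∀ (P Q : Set N.V), (∀ w, w ∈ P → w ∉ Q) →
        (∀ y, y ≠ x → N.leaf y ∈ P ∨ N.leaf y ∈ Q) →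
        (∀ y, N.leaf y ∈ P → y ≠ x) → (∀ y, N.leaf y ∈ Q → y ≠ x) →
        (∀ y z, y ∈ Y' → z ∈ Z' → N.leaf y ∈ P → N.leaf z ∈ P → False) →
        (∀ y z, y ∈ Y' → z ∈ Z' → N.leaf y ∈ Q → N.leaf z ∈ Q → False) →
        N.leaf p ∈ P → Y' = {y | N.leaf y ∈ P} ∧ Z' = {y | N.leaf y ∈ Q} := by
      intro P Q k1 k2 k3 k4 k5 k6 k7
      have hqQ : N.leaf q ∈ Q := by
        rcases k2 q (nx q (Or.inr hq)) with h | h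
        · exact (k5 p q hp hq k7 h).elim
        · exact h
      constructor
      · ext y
        constructor
        · intro hy
          rcases k2 y (nx y (Or.inl hy)) with h | h
          · exact h
          · exact (k6 y q hy hq h hqQ).elim
        · intro hy
          rcases cov' y (k3 y hy) with h | h
          · exact h
          · exact (k5 p y hp h k7 hy).elim
      · ext y
        constructor
        · intro hy
          rcases k2 y (nx y (Or.inr hy)) with h | h
          · exact (k5 p y hp hy k7 h).elim
          · exact h
        · intro hy
          rcases cov' y (k4 y hy) with h | h
          · exact (k6 y q h hq hy hqQ).elim
          · exact h
    rcases hcover p (nx p (Or.inl hp)) with h | h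
    · exact Or.inl (ext' A B hdisj hcover hneA hneB sepA sepB h)
    · exact Or.inr (ext' B A (fun w h1 h2 => hdisj w h2 h1) (fun y hy => (hcover y hy).symm)
        hneB hneA sepB sepA h)

/-- `c` is a vertex of the non-bridge component of `v`, other than `v`, from which a leaf in
`Y` hangs. -/
def Hang (N : LabGraph X) (v : N.V) (Y : Set X) (c : N.V) : Prop :=
  (NB N.G).Reachable v c ∧ c ≠ v ∧ ∃ b S, IsSide N.G S c b ∧ ∃ y ∈ Y, N.leaf y ∈ S

theorem Hang.not_full {N : LabGraph X} (hN : Net_s8 N) {v c : N.V} {Y : Set X}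
    (h : Hang N v Y c) : ¬ Full N.G c := by
  rintro ⟨n, m, k, h1, h2, h3, h4, h5, h6⟩
  obtain ⟨_, _, b, S, hS, _⟩ := h
  have hb : ∀ a, (NB N.G).Adj c a → a ≠ b := by
    rintro a ha rfl
    exact ha.2 hS.bridge
  have e1 := hb _ h4
  have e2 := hb _ h5
  have e3 := hb _ h6
  have hsub : ({n, m, k, b} : Set N.V) ⊆ N.G.neighborSet c := by
    intro a ha
    rcases ha with rfl | rfl | rfl | rfl
    exacts [h4.1, h5.1, h6.1, hS.adj]
  have := Set.ncard_le_ncard hsub (Set.toFinite _)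
  rw [Set.ncard_insert_of_notMem (by simp; grind) (by simp),
    Set.ncard_insert_of_notMem (by simp; grind) (by simp), Set.ncard_pair e3] at this
  have := hN.h3 c
  omega

theorem dist_two_s8 {G : SimpleGraph V} (hG : G.Connected) {a b : V} (hne : a ≠ b)
    (h : G.dist a b ≤ 2) : G.Adj a b ∨ ∃ m, G.Adj a m ∧ G.Adj m b := by
  obtain ⟨p, hp⟩ := hG.exists_walk_length_eq_dist a b
  cases p with
  | nil => exact absurd rfl hne
  | cons h1 q =>
    cases q with
    | nil => exact Or.inl h1
    | cons h2 r =>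
      cases r with
      | nil => exact Or.inr ⟨_, h1, h2⟩
      | cons h3 s => simp at hp; omega

theorem Net_s8.backward {N : LabGraph X} (hN : Net_s8 N) (hlev : N.IsLevel 2)
    (hX : 3 ≤ Fintype.card X) {x : X} {v n : N.V} (hv : ∀ u, N.G.Adj (N.leaf x) u ↔ u = v)
    (hn : (NB N.G).Adj v n) (Y Z : Set X) (hgp : GoodPartition N x Y Z) : False := by
  classical
  obtain ⟨g1, g2, g3, g4, g5⟩ := hgp
  have hvr := hN.nbr_notleaf hX hv
  have hxv : N.G.Adj v (N.leaf x) := ((hv v).2 rfl).symm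
  have hcovX : ∀ y, y ≠ x → y ∈ Y ∨ y ∈ Z := by
    intro y hy
    have : y ∈ Y ∪ Z := by rw [g1]; exact hy
    exact this
  have nx : ∀ y, y ∈ Y ∨ y ∈ Z → y ≠ x := by
    intro y hy
    have : y ∈ ({x}ᶜ : Set X) := by rw [← g1]; exact hy
    exact this
  obtain ⟨n', hne, hn', _⟩ := NB_second hn
  have hnx : n ≠ N.leaf x := fun e => hN.leaf_no_NB x v (e ▸ hn.symm)
  have hnx' : n' ≠ N.leaf x := fun e => hN.leaf_no_NB x v (e ▸ hn'.symm)
  have hvn : ∀ u, N.G.Adj v u → u = N.leaf x ∨ u = n ∨ u = n' := by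
    obtain ⟨a, b, c, h1, h2, h3, h4⟩ := hN.hI v hvr
    have e1 := (h4 _).1 hxv
    have e2 := (h4 _).1 hn.1
    have e3 := (h4 _).1 hn'.1
    intro u hu
    have e4 := (h4 _).1 hu
    grind
  have hvNB : ∀ u, (NB N.G).Adj v u → u = n ∨ u = n' := by
    intro u hu
    rcases hvn u hu.1 with rfl | h
    · exact (hN.leaf_no_NB x v hu.symm).elim
    · exact h
  have hxs := hN.leaf_side hv
  have hdx : ∀ y, y ≠ x → N.G.dist (N.leaf x) (N.leaf y) = 1 + N.G.dist v (N.leaf y) := by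
    intro y hy
    have := hxs.dist hN.conn (w := N.leaf x) (z := N.leaf y) rfl
      (fun h => hy (hN.inj h))
    rw [dist_self] at this
    omega
  -- the component avoids the sides hanging from it
  have hvS : ∀ c b S, (NB N.G).Reachable v c → IsSide N.G S c b → v ∉ S :=
    fun c b S hc hS h => hS.notp (hS.closed hc h)
  have hdy : ∀ c b S y, (NB N.G).Reachable v c → IsSide N.G S c b → N.leaf y ∈ S →
      N.G.dist v (N.leaf y) = N.G.dist v c + 1 + N.G.dist b (N.leaf y) := by
    intro c b S y hc hS hy
    have := hS.dist hN.conn hy (hvS c b S hc hS)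
    rw [dist_comm, this, dist_comm (u := c), dist_comm (u := b)]
    omega
  have hxS : ∀ c b S, (NB N.G).Reachable v c → c ≠ v → IsSide N.G S c b → N.leaf x ∉ S :=
    fun c b S hc hcv hS h => hcv (hS.exit _ _ h (hvS c b S hc hS) hxv.symm).2.symm
  have hd : ∀ c c', Hang N v Y c → Hang N v Z c' →
      N.G.dist v c + N.G.dist v c' ≤ N.G.dist c c' := by
    rintro c c' ⟨hc, hcv, b, S, hS, y, hy, hyS⟩ ⟨hc', hcv', b', S', hS', z, hz, hzS⟩
    have e0 := g5 y hy z hz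
    unfold dm at e0
    have e1 := hdx y (nx y (Or.inl hy))
    have e2 := hdx z (nx z (Or.inr hz))
    have e3 := hdy c b S y hc hS hyS
    have e4 := hdy c' b' S' z hc' hS' hzS
    have t1 := hN.conn.dist_triangle (u := N.leaf y) (v := b) (w := N.leaf z)
    have t2 := hN.conn.dist_triangle (u := b) (v := c) (w := N.leaf z)
    have t3 := hN.conn.dist_triangle (u := c) (v := c') (w := N.leaf z)
    have t4 := hN.conn.dist_triangle (u := c') (v := b') (w := N.leaf z)
    have a1 : N.G.dist b c = 1 := dist_eq_one_iff_adj.mpr hS.adj.symm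
    have a2 : N.G.dist c' b' = 1 := dist_eq_one_iff_adj.mpr hS'.adj
    rw [dist_comm (u := N.leaf y) (v := b)] at t1
    omega
  -- every leaf hangs somewhere
  have hhang : ∀ W : Set X, (∀ y ∈ W, y ≠ x) → ∀ y ∈ W, ∃ c, Hang N v W c := by
    intro W hW y hy
    have key : ∀ (a v' : N.V) (r : N.G.Walk a v'), v' = v → ¬ (NB N.G).Reachable v a →
        ∃ c b S, (NB N.G).Reachable v c ∧ IsSide N.G S c b ∧ a ∈ S := by
      intro a v' r
      induction r with
      | nil => rintro rfl h; exact absurd (Reachable.refl _) h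
      | @cons a a' _ hh t ih =>
        intro hv' ha
        by_cases ha' : (NB N.G).Reachable v a'
        · have hb : N.G.IsBridge s(a', a) := by
            by_contra hb
            exact ha (ha'.trans (Adj.reachable ⟨hh.symm, hb⟩))
          obtain ⟨S, hS⟩ := exists_side hh.symm hb
          exact ⟨a', a, S, ha', hS, hS.memq⟩
        · obtain ⟨c, b, S, h1, h2, h3⟩ := ih hv' ha'
          refine ⟨c, b, S, h1, h2, ?_⟩
          by_contra h4
          exact ha ((h2.exit _ _ h3 h4 hh.symm).2 ▸ h1)
    obtain ⟨r⟩ := hN.conn.preconnected (N.leaf y) v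
    have hyC : ¬ (NB N.G).Reachable v (N.leaf y) := by
      intro h
      obtain ⟨p⟩ := h.symm
      cases p with
      | nil => exact hvr ⟨y, rfl⟩
      | cons h _ => exact hN.leaf_no_NB y _ h
    obtain ⟨c, b, S, h1, h2, h3⟩ := key _ _ r rfl hyC
    refine ⟨c, h1, ?_, b, S, h2, y, hy, h3⟩
    rintro rfl
    have hb : b = N.leaf x := by
      rcases hvn b h2.adj with h | rfl | rfl
      · exact h
      · exact (hn.2 h2.bridge).elim
      · exact (hn'.2 h2.bridge).elim
    subst hb
    have e1 := h2.dist hN.conn h3 h2.notp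
    have e2 := hdx y (hW y hy)
    rw [dist_self] at e1
    rw [dist_comm, dist_comm (u := c)] at e2
    omega
  obtain ⟨y, hy⟩ := Set.nonempty_iff_ne_empty.2 g3
  obtain ⟨z, hz⟩ := Set.nonempty_iff_ne_empty.2 g4
  obtain ⟨c0, hc0⟩ := hhang Y (fun y hy => nx y (Or.inl hy)) y hy
  obtain ⟨c1, hc1⟩ := hhang Z (fun y hy => nx y (Or.inr hy)) z hz
  have hpos : ∀ c, c ≠ v → 1 ≤ N.G.dist v c := by
    intro c hc
    have := hN.conn.pos_dist_of_ne hc.symm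
    omega
  have hcomp : ∀ w u, w ≠ v → (NB N.G).Reachable v w → (NB N.G).Adj w u →
      Hang N v Y w ∨ Hang N v Z w ∨ (Full N.G w ∧ (NB N.G).Reachable v w) := by
    intro w u hwv hw hwu
    by_cases hf : Full N.G w
    · exact Or.inr (Or.inr ⟨hf, hw⟩)
    have hwr : w ∉ Set.range N.leaf := by
      rintro ⟨y, rfl⟩
      exact hN.leaf_no_NB _ _ hwu
    obtain ⟨a, b, c, h1, h2, h3, h4⟩ := hN.hI w hwr
    have hbr : ∃ d, N.G.Adj w d ∧ N.G.IsBridge s(w, d) := by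
      by_contra! hcon
      have q1 := (h4 a).2 (by simp)
      have q2 := (h4 b).2 (by simp)
      have q3 := (h4 c).2 (by simp)
      exact hf ⟨a, b, c, h1, h2, h3, ⟨q1, hcon _ q1⟩, ⟨q2, hcon _ q2⟩, ⟨q3, hcon _ q3⟩⟩
    obtain ⟨d, hd1, hd2⟩ := hbr
    obtain ⟨S, hS⟩ := exists_side hd1 hd2
    obtain ⟨y, hy⟩ := hN.side_leaf hlev _ S w d rfl hS
    have hyx : y ≠ x := fun e => hxS w d S hw hwv hS (e ▸ hy)
    rcases hcovX y hyx with h | h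
    · exact Or.inl ⟨hw, hwv, d, S, hS, y, h, hy⟩
    · exact Or.inr (Or.inl ⟨hw, hwv, d, S, hS, y, h, hy⟩)
  have hadj1 : ∀ c, c ≠ v → (NB N.G).Reachable v c → N.G.dist v c ≤ 1 → (NB N.G).Adj c v := by
    intro c hcv hc h
    have h1 := hpos c hcv
    have h2 : N.G.Adj v c := dist_eq_one_iff_adj.mp (by omega)
    exact (NB_adj_of_reachable hc h2).symm
  have hadj2 : ∀ c, c ≠ v → (NB N.G).Reachable v c → N.G.dist v c ≤ 2 → (NB N.G).Adj c v ∨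
      ∃ m, (NB N.G).Adj c m ∧ (NB N.G).Adj m v := by
    intro c hcv hc h
    rcases dist_two_s8 hN.conn hcv.symm h with h | ⟨m, h1, h2⟩
    · exact Or.inl (NB_adj_of_reachable hc h).symm
    · have hm : (NB N.G).Adj v m := by
        rcases hvn m h1 with rfl | rfl | rfl
        · exact absurd ((hv c).1 h2) hcv
        · exact hn
        · exact hn'
      refine Or.inr ⟨m, ?_, hm.symm⟩
      exact (NB_adj_of_reachable (hm.symm.reachable.trans hc) h2).symm
  have one : ∀ a b, (NB N.G).Adj a b → N.G.dist a b = 1 :=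
    fun a b h => dist_eq_one_iff_adj.mpr h.1
  have degH : ∀ (W : Set X) u a b c, Hang N v W u → (NB N.G).Adj u a → (NB N.G).Adj u b →
      (NB N.G).Adj u c → a = b ∨ a = c ∨ b = c := by
    intro W u a b c hu h1 h2 h3
    by_contra! hcon
    exact hu.not_full hN ⟨a, b, c, hcon.1, hcon.2.1, hcon.2.2, h1, h2, h3⟩
  have cfg : Cfg (NB N.G).Adj v n n' (Hang N v Y) (Hang N v Z)
      (fun w => Full N.G w ∧ (NB N.G).Reachable v w) := by
    refine ⟨fun a b h => h.symm, fun a h => h.ne rfl, hvNB, fun u h h' => h.not_full hN h'.1,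
      fun u h h' => h.not_full hN h'.1, ?_, fun h => h.2.1 rfl, fun h => h.2.1 rfl, ?_, ?_, ?_,
      degH Y, degH Z, ?_, ?_, ?_, ?_⟩
    · intro u h1 h2
      have := hd u u h1 h2
      have := hpos u h1.2.1
      rw [dist_self] at *
      omega
    · rintro ⟨⟨a, b, c, h1, h2, h3, h4, h5, h6⟩, _⟩
      have e1 := hvNB _ h4
      have e2 := hvNB _ h5
      have e3 := hvNB _ h6
      grind
    · rintro u w ⟨_, hu⟩ huw
      by_cases hw : w = v
      · exact Or.inl hw
      · exact Or.inr (hcomp w u hw (hu.trans huw.reachable) huw.symm)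
    · intro u hu
      exact hu.1
    · intro a b c ha hb hc _ _
      by_contra! hcon
      exact no_three_full N hN.h3 hlev hcon.1 hcon.2.1 hcon.2.2 ha.1 hb.1 hc.1
        (ha.2.symm.trans hb.2) (ha.2.symm.trans hc.2)
    · intro c c' h1 h2 h3
      have e1 := hd c c' h1 h2
      have e2 := hpos c h1.2.1
      have e3 := hpos c' h2.2.1
      have e4 := one _ _ h3
      omega
    · intro c u c' h1 h2 h3 h4
      have e1 := hd c c' h1 h2
      have e2 := hpos c h1.2.1
      have e3 := hpos c' h2.2.1
      have e4 := one _ _ h3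
      have e5 := one _ _ h4
      have e6 := hN.conn.dist_triangle (u := c) (v := u) (w := c')
      exact ⟨hadj1 c h1.2.1 h1.1 (by omega), hadj1 c' h2.2.1 h2.1 (by omega)⟩
    · intro c u w c' h1 h2 h3 h4 h5
      have e1 := hd c c' h1 h2
      have e2 := hpos c h1.2.1
      have e3 := hpos c' h2.2.1
      have e4 := one _ _ h3
      have e5 := one _ _ h4
      have e6 := one _ _ h5
      have e7 := hN.conn.dist_triangle (u := c) (v := u) (w := c')
      have e8 := hN.conn.dist_triangle (u := u) (v := w) (w := c')
      by_cases h : N.G.dist v c ≤ 1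
      · exact Or.inl ⟨hadj1 c h1.2.1 h1.1 h, hadj2 c' h2.2.1 h2.1 (by omega)⟩
      · exact Or.inr ⟨hadj1 c' h2.2.1 h2.1 (by omega), hadj2 c h1.2.1 h1.1 (by omega)⟩
  -- a crossing edge
  obtain ⟨p, hp⟩ := NB_avoid (hN.h3 v) (Set.toFinite _) (hc0.1.symm.trans hc1.1) hc0.2.1 hc1.2.1
  let P : Set N.V := {w | Hang N v Y w ∨ ((Full N.G w ∧ (NB N.G).Reachable v w) ∧
    ∃ c, Hang N v Y c ∧ (NB N.G).Adj c w)}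
  have hc1P : c1 ∉ P := by
    rintro (h | h)
    · exact cfg.nYZ c1 h hc1
    · exact cfg.nZF c1 hc1 h.1
  obtain ⟨d, hdp, hd1, hd2⟩ := p.exists_boundary_dart P (Or.inl hc0) hc1P
  have hsv : d.snd ≠ v := fun e => hp (e ▸ p.dart_snd_mem_support_of_mem_darts hdp)
  have hadj := d.adj
  have hr1 : (NB N.G).Reachable v d.fst := by
    rcases hd1 with h | h
    · exact h.1
    · exact h.1.2
  rcases hcomp d.snd d.fst hsv (hr1.trans hadj.reachable) hadj.symm with h | h | h
  · exact hd2 (Or.inl h)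
  · rcases hd1 with h1 | ⟨h1, c, h2, h3⟩
    · exact cfg.ha _ _ h1 h hadj
    · exact cfg.case1 h2 h h1 h3 hadj
  · rcases hd1 with h1 | ⟨h1, c, h2, h3⟩
    · exact hd2 (Or.inr ⟨h, _, h1, hadj⟩)
    · -- `d.snd` is full with no neighbour in the `Y` class
      obtain ⟨t, ht1, ht2, ht⟩ := third (cfg.hF _ h) d.fst v
      rcases cfg.cov _ _ h ht with e | e | e | e
      · exact ht2 e
      · exact hd2 (Or.inr ⟨h, t, e, ht.symm⟩)
      · exact cfg.case2 h2 e h1 h h3 hadj ht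
      · rcases cfg.h3 _ _ _ h1 h e hadj (Or.inr ht) with e | e | e
        · exact hadj.ne e
        · exact ht1 e.symm
        · exact ht.ne e

end Helpers

/-- Lemma 4: In a level-2 network on at least 3 leaves, a leaf `x` is not contained
in a blob if and only if there is a unique (unordered) partition `Y ∪ Z` of `X \ {x}`
into non-empty parts with `d_m(y,z) = d_m(x,y) + d_m(x,z) - 2` for all `y ∈ Y`, `z ∈ Z`. -/
theorem leaf_not_in_blob_iff_unique_partition
    (X : Type) [Fintype X] [DecidableEq X] (hX : 3 ≤ Fintype.card X)
    (N : LabGraph X) (hN : N.IsNetwork) (hlev : N.IsLevel 2) (x : X) :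
    (¬ ∃ H : N.G.Subgraph, N.IsBlob H ∧ N.LeafInBlob x H) ↔
      ∃ Y Z : Set X, GoodPartition N x Y Z ∧
        ∀ Y' Z' : Set X, GoodPartition N x Y' Z' →
          (Y' = Y ∧ Z' = Z) ∨ (Y' = Z ∧ Z' = Y) := by
  have net := hN.net hX
  obtain ⟨v, hv⟩ := net.hL x
  constructor
  · intro hno
    refine net.forward hlev hX hv ?_
    intro n hn
    obtain ⟨H, hH, hle⟩ := exists_blob_s8 N net.h3 hn
    exact hno ⟨H, hH, v, (hv v).2 rfl, hle.1 (Reachable.refl v)⟩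
  · rintro ⟨Y, Z, hg, _⟩ ⟨H, hH, w, hw, hwH⟩
    obtain rfl := (hv w).1 hw
    obtain ⟨n, hn⟩ := blob_NB N hH.1 hwH
    exact net.backward hlev hX hv hn Y Z hg

end LabGraph
end
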